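/- arXiv:1008.3475 — 3 statements merged into one kernel-verified Lean document; each statement's English description precedes it below -/
import Mathlib

section
/- For all integers n ≥ 0, the number of overpartitions of 3n into odd parts satisfies p̄_o(3n) ≡ f(n)·R(n, x²+6y²) (mod 3), where f(n) = -1 if n ≡ 1, 6, 9 or 10 (mod 12) and f(n) = 1 otherwise. -/
/-- Number of overpartitions of `n` into odd parts: pairs consisting of a
partition of some `m ≤ n` into distinct odd parts (the overlined parts)
and a partition of `n - m` into odd parts. -/
def pbarOdd (n : ℕ) : ℕ :=
  ∑ m ∈ Finset.range (n + 1),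
    (Nat.Partition.oddDistincts m).card * (Nat.Partition.odds (n - m)).card

/-- `R(n, x² + 6y²)`: number of representations of `n` by `x² + 6y²`. -/
noncomputable def R16 (n : ℕ) : ℕ := Nat.card {p : ℤ × ℤ // p.1 ^ 2 + 6 * p.2 ^ 2 = (n : ℤ)}

/-- `f(n) = -1` if `n ≡ 1, 6, 9, 10 (mod 12)` and `1` otherwise. -/
def f (n : ℕ) : ℤ :=
  if n % 12 = 1 ∨ n % 12 = 6 ∨ n % 12 = 9 ∨ n % 12 = 10 then -1 else 1

open PowerSeries PowerSeries.WithPiTopology Filter Topology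

/-- A form of Gauss's theta identity truncated to finitely many terms. -/
theorem one_add_two_mul_sum_mul_prod_one_add {R : Type*} [CommRing R] (x : R) (n : ℕ) :
    (1 + 2 * ∑ k ∈ Finset.range n, (-1) ^ (k + 1) * x ^ (k + 1) ^ 2) *
        ∏ k ∈ Finset.range n, (1 + x ^ (k + 1)) =
      ∑ s ∈ Finset.range (n + 1), (-1) ^ s * x ^ (s * (n + 1)) *
        (∏ k ∈ Finset.range s, (1 + x ^ k)) * ∏ k ∈ Finset.Ico s n, (1 - x ^ (k + 1)) := by
  induction n with
  | zero => simp
  | succ n ih =>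
    have telescope (m : ℕ) (hm : m ≤ n + 1) :
        ∑ s ∈ Finset.range m, ((-1) ^ s * x ^ (s * (n + 2)) *
            (∏ k ∈ Finset.range s, (1 + x ^ k)) * ∏ k ∈ Finset.Ico s (n + 1), (1 - x ^ (k + 1))) =
          (1 + x ^ (n + 1)) * ∑ s ∈ Finset.range m, ((-1) ^ s * x ^ (s * (n + 1)) *
            (∏ k ∈ Finset.range s, (1 + x ^ k)) * ∏ k ∈ Finset.Ico s n, (1 - x ^ (k + 1))) +
          if m = 0 then 0 else (-1) ^ m * x ^ (m * (n + 1)) *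
            (∏ k ∈ Finset.range m, (1 + x ^ k)) * ∏ k ∈ Finset.Ico (m - 1) n, (1 - x ^ (k + 1)) := by
      induction m with
      | zero => simp
      | succ m ihm =>
        rw [Finset.sum_range_succ, Finset.sum_range_succ, ihm (by omega),
          Finset.prod_range_succ _ m, Finset.prod_Ico_succ_top (by omega)]
        rcases m with _ | m
        · simp
          ring
        · have h : ∏ k ∈ Finset.Ico m n, (1 - x ^ (k + 1)) =
              (1 - x ^ (m + 1)) * ∏ k ∈ Finset.Ico (m + 1) n, (1 - x ^ (k + 1)) :=
            Finset.prod_eq_prod_Ico_succ_bot (by omega) _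
          simp only [Nat.add_sub_cancel, h, Nat.add_eq_zero_iff, one_ne_zero, and_false, if_false]
          ring
    rw [Finset.sum_range_succ _ (n + 1), telescope (n + 1) le_rfl, ← ih,
      Finset.sum_range_succ, Finset.prod_range_succ _ n]
    have h : ∏ k ∈ Finset.range (n + 1), (1 + x ^ k) =
        2 * ∏ k ∈ Finset.range n, (1 + x ^ (k + 1)) := by
      rw [Finset.prod_range_succ']
      norm_num [mul_comm]
    simp [h]
    ring

section AltSign

variable {R : Type*} [CommRing R]

/-- The sign `(-1) ^ k` of an integer `k`, in a ring `R`. -/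
def altSign (R : Type*) [CommRing R] (k : ℤ) : R := ((k.negOnePow : ℤ) : R)

theorem altSign_add (a b : ℤ) : altSign R (a + b) = altSign R a * altSign R b := by
  simp [altSign, Int.negOnePow_add]

theorem altSign_eq_of_even_sub {a b : ℤ} (h : Even (a - b)) : altSign R a = altSign R b := by
  rw [altSign, altSign, (Int.negOnePow_eq_iff a b).mpr h]

theorem altSign_add_altSign_of_odd_sub {a b : ℤ} (h : Odd (a - b)) :
    altSign R a + altSign R b = 0 := by
  have h1 : a.negOnePow = -b.negOnePow := by
    rw [← Int.negOnePow_succ]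
    exact (Int.negOnePow_eq_iff _ _).mpr (by grind)
  simp [altSign, h1]

theorem altSign_natCast (k : ℕ) : altSign R k = (-1) ^ k := by
  simp [altSign, Int.negOnePow_def]

end AltSign

section Theta

variable {R : Type*} [CommRing R] [TopologicalSpace R]

theorem summable_monomial_of_finite_fibers {ι : Type*} (Q : ι → ℕ) (w : ι → R)
    (hQ : ∀ n, {v | Q v = n}.Finite) : Summable fun v ↦ monomial (Q v) (w v) := by
  refine (summable_iff_summable_coeff _).mpr fun n ↦ summable_of_hasFiniteSupport ?_
  refine (hQ n).subset fun v hv ↦ ?_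
  by_contra h
  simp [coeff_monomial, Ne.symm h] at hv

/-- The theta series `∑ ε(k) X ^ (d k²)` over all integers `k`. -/
noncomputable def thetaSeries (ε : ℤ → R) (d : ℕ) : R⟦X⟧ :=
  ∑' k : ℤ, monomial (d * k.natAbs ^ 2) (ε k)

theorem finite_natAbs_le (n : ℕ) : {k : ℤ | k.natAbs ≤ n}.Finite :=
  (Set.finite_Icc (-n : ℤ) n).subset fun k hk ↦ by
    simp only [Set.mem_ofPred_eq, Set.mem_Icc] at hk ⊢
    omega

theorem natAbs_le_of_mul_sq_le {d n : ℕ} {k : ℤ} (hd : 0 < d) (h : d * k.natAbs ^ 2 ≤ n) :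
    k.natAbs ≤ n := by
  nlinarith [Nat.le_self_pow two_ne_zero k.natAbs]

theorem hasSum_thetaSeries (ε : ℤ → R) {d : ℕ} (hd : 0 < d) :
    HasSum (fun k : ℤ ↦ monomial (d * k.natAbs ^ 2) (ε k)) (thetaSeries ε d) :=
  (summable_monomial_of_finite_fibers _ _ fun n ↦ (finite_natAbs_le n).subset fun _ hk ↦
    natAbs_le_of_mul_sq_le hd (le_of_eq hk)).hasSum

theorem hasSum_thetaSeries_mul [T2Space R] [IsTopologicalRing R] (ε₁ ε₂ : ℤ → R) {d₁ d₂ : ℕ}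
    (h₁ : 0 < d₁) (h₂ : 0 < d₂) :
    HasSum (fun v : ℤ × ℤ ↦
      monomial (d₁ * v.1.natAbs ^ 2 + d₂ * v.2.natAbs ^ 2) (ε₁ v.1 * ε₂ v.2))
      (thetaSeries ε₁ d₁ * thetaSeries ε₂ d₂) := by
  have h := (hasSum_thetaSeries ε₁ h₁).mul (hasSum_thetaSeries ε₂ h₂)
  simp only [monomial_mul_monomial] at h
  refine h (summable_monomial_of_finite_fibers _ _ fun n ↦
    ((finite_natAbs_le n).prod (finite_natAbs_le n)).subset fun v hv ↦ ?_)
  exact ⟨natAbs_le_of_mul_sq_le h₁ (by simp only [Set.mem_ofPred_eq] at hv; omega),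
    natAbs_le_of_mul_sq_le h₂ (by simp only [Set.mem_ofPred_eq] at hv; omega)⟩

theorem hasSum_thetaSeries_mul_mul [T2Space R] [IsTopologicalRing R] (ε₁ ε₂ ε₃ : ℤ → R)
    {d₁ d₂ d₃ : ℕ} (h₁ : 0 < d₁) (h₂ : 0 < d₂) (h₃ : 0 < d₃) :
    HasSum (fun v : (ℤ × ℤ) × ℤ ↦
      monomial (d₁ * v.1.1.natAbs ^ 2 + d₂ * v.1.2.natAbs ^ 2 + d₃ * v.2.natAbs ^ 2)
        (ε₁ v.1.1 * ε₂ v.1.2 * ε₃ v.2))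
      (thetaSeries ε₁ d₁ * thetaSeries ε₂ d₂ * thetaSeries ε₃ d₃) := by
  have h := (hasSum_thetaSeries_mul ε₁ ε₂ h₁ h₂).mul (hasSum_thetaSeries ε₃ h₃)
  simp only [monomial_mul_monomial] at h
  refine h (summable_monomial_of_finite_fibers _ _ fun n ↦
    (((finite_natAbs_le n).prod (finite_natAbs_le n)).prod (finite_natAbs_le n)).subset
      fun v hv ↦ ?_)
  exact ⟨⟨natAbs_le_of_mul_sq_le h₁ (by simp only [Set.mem_ofPred_eq] at hv; omega),
    natAbs_le_of_mul_sq_le h₂ (by simp only [Set.mem_ofPred_eq] at hv; omega)⟩,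
    natAbs_le_of_mul_sq_le h₃ (by simp only [Set.mem_ofPred_eq] at hv; omega)⟩

theorem tendsto_sum_thetaSeries [T2Space R] [IsTopologicalRing R] {d : ℕ} (hd : 0 < d) :
    Tendsto (fun n ↦ 1 + 2 * ∑ k ∈ Finset.range n,
      (-1 : R⟦X⟧) ^ (k + 1) * ((X : R⟦X⟧) ^ d) ^ (k + 1) ^ 2) atTop
      (𝓝 (thetaSeries (altSign R) d)) := by
  have h := (hasSum_thetaSeries (altSign R) hd).nat_add_neg.tendsto_sum_nat
  have h2 := (tendsto_add_atTop_iff_nat 1).mpr h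
  have h0 : altSign R 0 = 1 := by simpa using altSign_natCast (R := R) 0
  have hneg (k : ℕ) : altSign R (-k) = (-1) ^ k := by
    rw [← altSign_natCast, altSign_eq_of_even_sub]
    exact ⟨-k, by ring⟩
  have hmon (k : ℕ) : (monomial (d * k ^ 2)) ((-1 : R) ^ k) =
      (-1 : R⟦X⟧) ^ k * ((X : R⟦X⟧) ^ d) ^ k ^ 2 := by
    rw [monomial_eq_C_mul_X_pow, ← pow_mul]
    simp
  have h3 := h2.sub_const (1 : R⟦X⟧)
  simp only [Int.natAbs_natCast, Int.natAbs_neg, altSign_natCast, hneg, hmon] at h3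
  convert h3 using 2
  · rw [Finset.sum_range_succ', Finset.mul_sum]
    simp [two_mul]
    ring
  · simp [h0]

/-- **Gauss's theta identity** `∑ (-1) ^ k q ^ (k²) = ∏ (1 - q ^ n) / (1 + q ^ n)`, evaluated at
`q = X ^ d`. -/
theorem thetaSeries_altSign_mul_eq [T2Space R] [IsTopologicalRing R] {d : ℕ} (hd : 0 < d)
    {P M : R⟦X⟧} (hP : HasProd (fun k : ℕ ↦ 1 + ((X : R⟦X⟧) ^ d) ^ (k + 1)) P)
    (hM : HasProd (fun k : ℕ ↦ 1 - ((X : R⟦X⟧) ^ d) ^ (k + 1)) M) :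
    thetaSeries (altSign R) d * P = M := by
  have h := (tendsto_sum_thetaSeries (R := R) hd).mul hP.tendsto_prod_nat
  refine tendsto_nhds_unique h ?_
  have hrem : Tendsto (fun n ↦ ((∑ s ∈ Finset.range (n + 1), (-1) ^ s * (X ^ d) ^ (s * (n + 1)) *
        (∏ k ∈ Finset.range s, (1 + (X ^ d) ^ k)) *
        ∏ k ∈ Finset.Ico s n, (1 - (X ^ d) ^ (k + 1)) : R⟦X⟧) -
        ∏ k ∈ Finset.range n, (1 - (X ^ d) ^ (k + 1)))) atTop (𝓝 0) := by
    rw [tendsto_iff_coeff_tendsto]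
    refine fun m ↦ tendsto_atTop_of_eventually_const (i₀ := m) fun n (hn : m ≤ n) ↦ ?_
    rw [Finset.sum_range_succ']
    simp only [zero_mul, pow_zero, Finset.range_zero, Finset.prod_empty, one_mul,
      Nat.Ico_zero_eq_range, add_sub_cancel_right, map_zero, map_sum]
    refine Finset.sum_eq_zero fun s _ ↦ ?_
    suffices h : (X : R⟦X⟧) ^ (n + 1) ∣ (-1) ^ (s + 1) * (X ^ d) ^ ((s + 1) * (n + 1)) *
        (∏ k ∈ Finset.range (s + 1), (1 + (X ^ d) ^ k)) *
        ∏ k ∈ Finset.Ico (s + 1) n, (1 - (X ^ d) ^ (k + 1)) from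
      X_pow_dvd_iff.mp h m (by omega)
    refine Dvd.dvd.mul_right (Dvd.dvd.mul_right (Dvd.dvd.mul_left ?_ _) _) _
    rw [← pow_mul]
    refine pow_dvd_pow _ ?_
    calc n + 1 = 1 * (1 * (n + 1)) := by ring
      _ ≤ d * ((s + 1) * (n + 1)) := by gcongr <;> omega
  simp only [one_add_two_mul_sum_mul_prod_one_add]
  simpa using hrem.add hM.tendsto_prod_nat

/-- Gluing of the odd-indexed and even-indexed factors of a product. -/
theorem hasProd_of_odd_of_even [T2Space R] [IsTopologicalRing R] {F : ℕ → R⟦X⟧} {A B : R⟦X⟧}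
    (hA : HasProd (fun i ↦ if ¬Even (i + 1) then F (i + 1) else 1) A)
    (hB : HasProd (fun i ↦ F (2 * (i + 1))) B) :
    HasProd (fun i ↦ F (i + 1)) (A * B) := by
  have hinj : Function.Injective fun i : ℕ ↦ 2 * i + 1 := fun a b h ↦ by simpa using h
  have hB' : HasProd (fun i ↦ if Even (i + 1) then F (i + 1) else 1) B := by
    rw [← hinj.hasProd_iff]
    · convert hB using 2 with i
      simp [show 2 * i + 1 + 1 = 2 * (i + 1) by ring]
    · intro i hi
      rw [if_neg]
      rintro ⟨j, hj⟩
      exact hi ⟨j - 1, by simp only; omega⟩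
  convert! hA.mul hB' using 2 with i
  split_ifs <;> simp_all

theorem multipliable_one_add_X_pow_mul (s : R) {d : ℕ} (hd : 0 < d) :
    Multipliable fun k : ℕ ↦ 1 + C s * ((X : R⟦X⟧) ^ d) ^ (k + 1) := by
  nontriviality R
  apply multipliable_one_add_of_tendsto_order_atTop_nhds_top
  refine ENat.tendsto_nhds_top_iff_natCast_lt.mpr fun n ↦ eventually_atTop.mpr ⟨n, fun m hm ↦ ?_⟩
  rw [← pow_mul]
  grw [← le_order_mul]
  refine lt_add_of_nonneg_of_lt (by simp) ?_
  rw [order_X_pow]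
  norm_cast
  nlinarith

end Theta

section PartitionSeries

variable {R : Type*} [CommRing R] [TopologicalSpace R] [T2Space R]

theorem hasProd_powerSeriesMk_card_oddDistincts :
    HasProd (fun i ↦ if ¬Even (i + 1) then 1 + (X : R⟦X⟧) ^ (i + 1) else 1)
      (PowerSeries.mk fun n ↦ ((Nat.Partition.oddDistincts n).card : R)) := by
  convert! Nat.Partition.hasProd_genFun
    (fun i c ↦ if ¬Even i ∧ c < 2 then (1 : R) else 0) using 1
  · ext1 i
    rw [tsum_eq_single 0 (fun j hj ↦ by
      rw [if_neg (by omega), zero_smul])]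
    split_ifs <;> simp_all
  · simp_rw [Nat.Partition.genFun, Finsupp.prod, Finset.prod_boole]
    ext n
    simp only [coeff_mk, Nat.Partition.oddDistincts, Nat.Partition.odds, Nat.Partition.restricted,
      ← Nat.Partition.countRestricted_two, Nat.Partition.countRestricted,
      ← Finset.filter_and, Finset.card_filter]
    simp [forall_and]

theorem thetaSeries_altSign_ne_zero [IsTopologicalRing R] [Nontrivial R] :
    thetaSeries (altSign R) 1 ≠ 0 := fun h ↦ by
  have hadd := (multipliable_one_add_X_pow_mul (1 : R) one_pos).hasProd
  have hsub := (multipliable_one_sub_X_pow R).hasProd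
  simp only [map_one, one_mul] at hadd
  have := thetaSeries_altSign_mul_eq one_pos hadd (by simpa using hsub)
  rw [h, zero_mul] at this
  exact tprod_one_sub_X_pow_ne_zero R this.symm

/-- The generating function of overpartitions into odd parts, as a quotient of theta series. -/
theorem powerSeriesMk_pbarOdd_mul_thetaSeries [IsTopologicalRing R] [IsDomain R] :
    (PowerSeries.mk fun n ↦ (pbarOdd n : R)) * thetaSeries (altSign R) 1 =
      thetaSeries (altSign R) 2 := by
  set D : R⟦X⟧ := PowerSeries.mk fun n ↦ ((Nat.Partition.oddDistincts n).card : R)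
  set O : R⟦X⟧ := PowerSeries.mk fun n ↦ ((Nat.Partition.odds n).card : R)
  have hmul : (PowerSeries.mk fun n ↦ (pbarOdd n : R)) = D * O := by
    ext n
    rw [coeff_mul, Finset.Nat.sum_antidiagonal_eq_sum_range_succ_mk]
    simp [D, O, pbarOdd]
  have hadd := (multipliable_one_add_X_pow_mul (1 : R) two_pos).hasProd
  have hsub := (multipliable_one_add_X_pow_mul (-1 : R) two_pos).hasProd
  simp only [map_one, one_mul, map_neg, neg_mul, ← sub_eq_add_neg] at hadd hsub
  set E₁ := ∏' k : ℕ, (1 + ((X : R⟦X⟧) ^ 2) ^ (k + 1))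
  set E₂ := ∏' k : ℕ, (1 - ((X : R⟦X⟧) ^ 2) ^ (k + 1))
  have hD : HasProd _ D := hasProd_powerSeriesMk_card_oddDistincts (R := R)
  have hO : HasProd _ O := Nat.Partition.hasProd_powerSeriesMk_card_restricted R (¬Even ·)
  obtain ⟨N, hN⟩ : Multipliable fun i ↦ if ¬Even (i + 1) then 1 - (X : R⟦X⟧) ^ (i + 1) else 1 := by
    have h : Tendsto (fun i ↦ (if ¬Even (i + 1) then -(X : R⟦X⟧) ^ (i + 1) else 0).order)
        atTop (𝓝 ⊤) := by
      refine ENat.tendsto_nhds_top_iff_natCast_lt.mpr fun n ↦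
        eventually_atTop.mpr ⟨n, fun m hm ↦ ?_⟩
      split_ifs
      · simp
      · rw [order_neg, order_X_pow]
        norm_cast
        omega
    convert! multipliable_one_add_of_tendsto_order_atTop_nhds_top R h using 2 with i
    split_ifs <;> ring
  have hON : O * N = 1 := by
    refine (hO.mul hN).unique ?_
    convert! hasProd_one using 2 with i
    split_ifs with h
    · simp
    · simp only [pow_mul]
      exact tsum_pow_mul_one_sub_of_constantCoeff_eq_zero (by simp)
  have h2 := thetaSeries_altSign_mul_eq two_pos hadd hsub
  have hP : HasProd _ (D * E₁) := hasProd_of_odd_of_even (F := fun i ↦ 1 + (X : R⟦X⟧) ^ i) hD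
    (by simpa only [pow_mul] using hadd)
  have hM : HasProd _ (N * E₂) := hasProd_of_odd_of_even (F := fun i ↦ 1 - (X : R⟦X⟧) ^ i) hN
    (by simpa only [pow_mul] using hsub)
  have h1 : thetaSeries (altSign R) 1 * (D * E₁) = N * E₂ :=
    thetaSeries_altSign_mul_eq one_pos (by simpa only [pow_one] using hP)
      (by simpa only [pow_one] using hM)
  have hne : E₁ ≠ 0 := by
    intro h
    have h3 := congrArg constantCoeff
      (hadd.unique (by simpa [h] using hadd) : E₁ = 0)
    rw [(hadd.map constantCoeff (continuous_constantCoeff R)).tprod_eq.symm] at h3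
    simp at h3
  apply mul_right_cancel₀ hne
  rw [hmul, h2]
  linear_combination O * h1 + E₂ * hON

end PartitionSeries

section Multisection

variable {R : Type*} [CommRing R]

/-- The operator `∑ aₙ Xⁿ ↦ ∑ a_{mn} Xⁿ` on power series. -/
noncomputable def multisection (m : ℕ) : R⟦X⟧ →+ R⟦X⟧ where
  toFun p := PowerSeries.mk fun n ↦ coeff (m * n) p
  map_zero' := by ext; simp
  map_add' _ _ := by ext; simp

@[simp]
theorem coeff_multisection (m n : ℕ) (p : R⟦X⟧) :
    coeff n (multisection m p) = coeff (m * n) p :=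
  coeff_mk n fun n ↦ coeff (m * n) p

theorem multisection_monomial_mul {m : ℕ} (hm : 0 < m) (n : ℕ) (a : R) :
    multisection m (monomial (m * n) a) = monomial n a := by
  ext k
  simp [coeff_monomial, hm.ne']

theorem multisection_monomial_of_not_dvd {m n : ℕ} (h : ¬m ∣ n) (a : R) :
    multisection m (monomial n a) = 0 := by
  ext k
  rw [coeff_multisection, coeff_monomial, if_neg, map_zero]
  rintro rfl
  exact h ⟨k, rfl⟩

theorem multisection_mul_monomial {m : ℕ} (hm : 0 < m) (p : R⟦X⟧) (n : ℕ) (a : R) :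
    multisection m (p * monomial (m * n) a) = multisection m p * monomial n a := by
  ext k
  simp only [coeff_multisection, monomial_eq_C_mul_X_pow, ← mul_assoc, coeff_mul_X_pow',
    coeff_mul_C, mul_le_mul_iff_right₀ hm, Nat.mul_sub]

variable [TopologicalSpace R]

theorem continuous_multisection (m : ℕ) : Continuous (multisection m : R⟦X⟧ →+ R⟦X⟧) := by
  refine continuous_iff_continuousAt.mpr fun p ↦ ?_
  refine (tendsto_iff_coeff_tendsto _ _ _ _).mpr fun n ↦ ?_
  simp only [coeff_multisection]
  exact (continuous_coeff R (m * n)).tendsto p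

theorem multisection_mul_thetaSeries [T2Space R] [IsTopologicalRing R] {m : ℕ} (hm : 0 < m)
    (p : R⟦X⟧) (ε : ℤ → R) :
    multisection m (p * thetaSeries ε m) = multisection m p * thetaSeries ε 1 := by
  have h := ((hasSum_thetaSeries ε hm).mul_left p).map (multisection m) (continuous_multisection m)
  refine h.unique ?_
  convert! (hasSum_thetaSeries ε one_pos).mul_left (multisection m p) using 2 with k
  simp [multisection_mul_monomial hm]

end Multisection

section CharThree

theorem charP_powerSeries_zmod_three : CharP (ZMod 3)⟦X⟧ 3 :=
  charP_of_injective_ringHom (f := C) C_injective 3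

theorem three_eq_zero_powerSeries : (3 : (ZMod 3)⟦X⟧) = 0 := by
  have := charP_powerSeries_zmod_three
  exact_mod_cast CharP.cast_eq_zero (ZMod 3)⟦X⟧ 3

theorem thetaSeries_altSign_pow_three {d : ℕ} (hd : 0 < d) :
    thetaSeries (altSign (ZMod 3)) d ^ 3 = thetaSeries (altSign (ZMod 3)) (3 * d) := by
  have := charP_powerSeries_zmod_three
  have h := (hasSum_thetaSeries (altSign (ZMod 3)) hd).map (frobenius (ZMod 3)⟦X⟧ 3)
    (continuous_id.pow 3)
  refine h.unique ?_
  convert! hasSum_thetaSeries (altSign (ZMod 3)) (d := 3 * d) (by omega) using 2 with k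
  simp [frobenius_def, monomial_pow, mul_assoc]

theorem thetaSeries_one_mul_thetaSeries_altSign :
    thetaSeries (1 : ℤ → ZMod 3) 1 * thetaSeries (altSign (ZMod 3)) 1 =
      thetaSeries (altSign (ZMod 3)) 2 ^ 2 := by
  have h := hasSum_thetaSeries_mul (1 : ℤ → ZMod 3) (altSign (ZMod 3)) one_pos one_pos
  have hadd := h.add ((Equiv.prodComm ℤ ℤ).hasSum_iff.mpr h)
  let g : ℤ × ℤ → ℤ × ℤ := fun v ↦ (v.1 + v.2, v.1 - v.2)
  have hg : Function.Injective g := fun v w hvw ↦ by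
    simp only [g, Prod.mk.injEq] at hvw
    ext <;> omega
  rw [← hg.hasSum_iff] at hadd
  · have h2 := hasSum_thetaSeries_mul (altSign (ZMod 3)) (altSign (ZMod 3)) two_pos two_pos
    have h4 := hadd.unique (a₂ := _) (by
      convert! h2.add h2 using 2 with v
      obtain ⟨a, b⟩ := v
      have e1 : (a + b).natAbs ^ 2 + (a - b).natAbs ^ 2 = 2 * a.natAbs ^ 2 + 2 * b.natAbs ^ 2 := by
        zify
        simp only [sq_abs]
        ring
      have e2 : altSign (ZMod 3) (a - b) = altSign (ZMod 3) (a + b) :=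
        altSign_eq_of_even_sub ⟨-b, by ring⟩
      simp [g, e1, e2, add_comm ((a - b).natAbs ^ 2), altSign_add])
    linear_combination 2 * h4 - (thetaSeries (1 : ℤ → ZMod 3) 1 *
      thetaSeries (altSign (ZMod 3)) 1 - thetaSeries (altSign (ZMod 3)) 2 ^ 2) *
      three_eq_zero_powerSeries
  · rintro ⟨x, y⟩ hv
    have hodd : Odd (x - y) := by
      rw [← Int.not_even_iff_odd]
      rintro ⟨k, hk⟩
      exact hv ⟨(y + k, k), by simp only [g, Prod.mk.injEq]; omega⟩
    simp [add_comm (y.natAbs ^ 2), ← map_add, add_comm (altSign (ZMod 3) y),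
      altSign_add_altSign_of_odd_sub hodd]

/-- A similitude of factor `3` from the lattice of `a² + 2b² + 3c²` into the lattice of
`x² + y² + 2z²` carries theta series to theta series. -/
theorem hasSum_indicator_multisection_three {g : (ℤ × ℤ) × ℤ → (ℤ × ℤ) × ℤ}
    (hg : Function.Injective g)
    (hQ : ∀ a b c, (g ((a, b), c)).1.1 ^ 2 + (g ((a, b), c)).1.2 ^ 2 +
      2 * (g ((a, b), c)).2 ^ 2 = 3 * (a ^ 2 + 2 * b ^ 2 + 3 * c ^ 2))
    (hs : ∀ a b c, Even ((g ((a, b), c)).1.1 + (g ((a, b), c)).1.2 + (g ((a, b), c)).2 - (b + c))) :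
    HasSum (Set.indicator (Set.range g) fun v ↦ multisection 3 (monomial
        (1 * v.1.1.natAbs ^ 2 + 1 * v.1.2.natAbs ^ 2 + 2 * v.2.natAbs ^ 2)
        (altSign (ZMod 3) v.1.1 * altSign (ZMod 3) v.1.2 * altSign (ZMod 3) v.2)))
      (thetaSeries (1 : ℤ → ZMod 3) 1 * thetaSeries (altSign (ZMod 3)) 2 *
        thetaSeries (altSign (ZMod 3)) 3) := by
  rw [← hg.hasSum_iff fun v hv ↦ Set.indicator_of_notMem hv _]
  convert! hasSum_thetaSeries_mul_mul (1 : ℤ → ZMod 3) (altSign (ZMod 3)) (altSign (ZMod 3))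
    one_pos two_pos three_pos using 2 with v
  obtain ⟨⟨a, b⟩, c⟩ := v
  have e1 : 1 * (g ((a, b), c)).1.1.natAbs ^ 2 + 1 * (g ((a, b), c)).1.2.natAbs ^ 2 +
      2 * (g ((a, b), c)).2.natAbs ^ 2 =
      3 * (1 * a.natAbs ^ 2 + 2 * b.natAbs ^ 2 + 3 * c.natAbs ^ 2) := by
    zify
    simp only [sq_abs]
    linear_combination hQ a b c
  rw [Function.comp_apply, Set.indicator_of_mem (Set.mem_range_self _), e1,
    multisection_monomial_mul three_pos, ← altSign_add, ← altSign_add,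
    altSign_eq_of_even_sub (hs a b c), altSign_add]
  simp

/-- If `3 ∣ x² + y² + 2z²` then one or all four of the listed congruence conditions hold. -/
theorem sum_ite_of_three_dvd {x y z : ℤ} (h : (3 : ℤ) ∣ x ^ 2 + y ^ 2 + 2 * z ^ 2)
    (F : (ZMod 3)⟦X⟧) :
    ((if y % 3 = 0 ∧ (x - 1 * z) % 3 = 0 then F else 0) +
        if y % 3 = 0 ∧ (x - -1 * z) % 3 = 0 then F else 0) +
      ((if x % 3 = 0 ∧ (y - 1 * z) % 3 = 0 then F else 0) +
        if x % 3 = 0 ∧ (y - -1 * z) % 3 = 0 then F else 0) = F := by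
  have h3 : F + F + (F + F) = F := by linear_combination F * three_eq_zero_powerSeries
  have hsq (w : ℤ) : w % 3 = 0 ∧ w ^ 2 % 3 = 0 ∨ w % 3 = 1 ∧ w ^ 2 % 3 = 1 ∨
      w % 3 = 2 ∧ w ^ 2 % 3 = 1 := by
    have hw : w % 3 = 0 ∨ w % 3 = 1 ∨ w % 3 = 2 := by omega
    rcases hw with hw | hw | hw <;> simp [pow_two, Int.mul_emod, hw]
  have hx := hsq x
  have hy := hsq y
  have hz := hsq z
  generalize x ^ 2 = x' at *
  generalize y ^ 2 = y' at *
  generalize z ^ 2 = z' at *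
  split_ifs <;> first | exact h3 | simp only [add_zero, zero_add]
  all_goals
    exfalso
    clear h3 hsq
    omega

theorem multisection_three_thetaSeries_ternary :
    multisection 3 (thetaSeries (altSign (ZMod 3)) 1 * thetaSeries (altSign (ZMod 3)) 1 *
        thetaSeries (altSign (ZMod 3)) 2) =
      thetaSeries (1 : ℤ → ZMod 3) 1 * thetaSeries (altSign (ZMod 3)) 2 *
        thetaSeries (altSign (ZMod 3)) 3 := by
  have h := (hasSum_thetaSeries_mul_mul (altSign (ZMod 3)) (altSign (ZMod 3)) (altSign (ZMod 3))
    one_pos one_pos two_pos).map (multisection 3) (continuous_multisection 3)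
  let g (σ : ℤ) : (ℤ × ℤ) × ℤ → (ℤ × ℤ) × ℤ :=
    fun v ↦ ((v.1.1 + 2 * v.1.2, 3 * v.2), σ * (v.1.1 - v.1.2))
  let g' (σ : ℤ) : (ℤ × ℤ) × ℤ → (ℤ × ℤ) × ℤ := fun v ↦ ((g σ v).1.swap, (g σ v).2)
  have hg (σ : ℤ) (hσ : σ = 1 ∨ σ = -1) : Function.Injective (g σ) := fun v w hvw ↦ by
    simp only [g, Prod.mk.injEq] at hvw
    rcases hσ with rfl | rfl <;> ext <;> omega
  have hg' (σ : ℤ) (hσ : σ = 1 ∨ σ = -1) : Function.Injective (g' σ) := fun v w hvw ↦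
    hg σ hσ (by simp only [g', Prod.mk.injEq, Prod.swap_inj] at hvw; exact Prod.ext hvw.1 hvw.2)
  have hT (σ : ℤ) (hσ : σ = 1 ∨ σ = -1) := hasSum_indicator_multisection_three (hg σ hσ)
    (fun a b c ↦ by rcases hσ with rfl | rfl <;> simp only [g] <;> ring)
    (fun a b c ↦ by rcases hσ with rfl | rfl <;> simp only [g] <;> grind)
  have hT' (σ : ℤ) (hσ : σ = 1 ∨ σ = -1) := hasSum_indicator_multisection_three (hg' σ hσ)
    (fun a b c ↦ by rcases hσ with rfl | rfl <;> simp only [g, g', Prod.swap] <;> ring)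
    (fun a b c ↦ by rcases hσ with rfl | rfl <;> simp only [g, g', Prod.swap] <;> grind)
  have hmem (σ : ℤ) (hσ : σ = 1 ∨ σ = -1) (x y z : ℤ) :
      ((x, y), z) ∈ Set.range (g σ) ↔ y % 3 = 0 ∧ (x - σ * z) % 3 = 0 := by
    constructor
    · rintro ⟨v, hv⟩
      simp only [g, Prod.mk.injEq] at hv
      rcases hσ with rfl | rfl <;> omega
    · intro hv
      refine ⟨((σ * z + (x - σ * z) / 3, (x - σ * z) / 3), y / 3), ?_⟩
      simp only [g, Prod.mk.injEq]
      rcases hσ with rfl | rfl <;> omega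
  have hmem' (σ : ℤ) (x y z : ℤ) : ((x, y), z) ∈ Set.range (g' σ) ↔
      ((y, x), z) ∈ Set.range (g σ) := by
    simp [g', Prod.ext_iff, and_comm]
  have hsum := ((hT 1 (.inl rfl)).add (hT (-1) (.inr rfl))).add
    ((hT' 1 (.inl rfl)).add (hT' (-1) (.inr rfl)))
  have key := h.unique (a₂ := _) (by
    convert! hsum using 2 with v
    obtain ⟨⟨x, y⟩, z⟩ := v
    classical
    simp only [Function.comp_apply, Set.indicator_apply, hmem', hmem _ (.inl rfl),
      hmem _ (.inr rfl)]
    by_cases hdvd : 3 ∣ 1 * x.natAbs ^ 2 + 1 * y.natAbs ^ 2 + 2 * z.natAbs ^ 2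
    · generalize multisection 3 (monomial
        (1 * x.natAbs ^ 2 + 1 * y.natAbs ^ 2 + 2 * z.natAbs ^ 2)
        (altSign (ZMod 3) x * altSign (ZMod 3) y * altSign (ZMod 3) z)) = F
      refine (sum_ite_of_three_dvd ?_ F).symm
      simpa [sq_abs] using Int.natCast_dvd_natCast.mpr hdvd
    · simp only [multisection_monomial_of_not_dvd hdvd, ite_self, add_zero])
  rw [key]
  linear_combination (thetaSeries (1 : ℤ → ZMod 3) 1 * thetaSeries (altSign (ZMod 3)) 2 *
    thetaSeries (altSign (ZMod 3)) 3) * three_eq_zero_powerSeries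

theorem multisection_three_powerSeriesMk_pbarOdd :
    multisection 3 (PowerSeries.mk fun n ↦ (pbarOdd n : ZMod 3)) =
      thetaSeries (altSign (ZMod 3)) 1 * thetaSeries (altSign (ZMod 3)) 6 := by
  have hne := thetaSeries_altSign_ne_zero (R := ZMod 3)
  have hP := powerSeriesMk_pbarOdd_mul_thetaSeries (R := ZMod 3)
  have h3 := thetaSeries_altSign_pow_three one_pos
  have h6 := thetaSeries_altSign_pow_three two_pos
  have hU := multisection_mul_thetaSeries three_pos
    (PowerSeries.mk fun n ↦ (pbarOdd n : ZMod 3)) (altSign (ZMod 3))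
  have hT := multisection_three_thetaSeries_ternary
  have hQ := thetaSeries_one_mul_thetaSeries_altSign
  norm_num at h3 h6
  set P := PowerSeries.mk fun n ↦ (pbarOdd n : ZMod 3)
  set t := thetaSeries (altSign (ZMod 3))
  have hPt : P * t 3 = t 1 * t 1 * t 2 := by
    linear_combination t 1 ^ 2 * hP - P * h3
  apply mul_right_cancel₀ hne
  rw [← hU, hPt, hT]
  linear_combination t 1 ^ 2 * t 2 * hQ - thetaSeries 1 1 * t 2 * h3 + t 1 ^ 2 * h6

theorem altSign_mul_altSign_of_sq_add_six_mul_sq {x y : ℤ} {n : ℕ} (h : x ^ 2 + 6 * y ^ 2 = n) :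
    altSign (ZMod 3) x * altSign (ZMod 3) y = (f n : ZMod 3) := by
  have hx : x = 6 * (x / 6) + x % 6 := by omega
  have hy : y = 2 * (y / 2) + y % 2 := by omega
  have hr : 0 ≤ x % 6 ∧ x % 6 < 6 := by omega
  have hs : 0 ≤ y % 2 ∧ y % 2 < 2 := by omega
  generalize x / 6 = k at hx
  generalize x % 6 = r at hx hr
  generalize y / 2 = m at hy
  generalize y % 2 = s at hy hs
  subst hx hy
  have hn : (n : ℤ) = 12 * (3 * k ^ 2 + k * r + 2 * m ^ 2 + 2 * m * s) + (r ^ 2 + 6 * s ^ 2) := by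
    rw [← h]
    ring
  generalize 3 * k ^ 2 + k * r + 2 * m ^ 2 + 2 * m * s = t at hn
  rw [← altSign_add, altSign_eq_of_even_sub (b := r + s) ⟨3 * k + m, by ring⟩]
  obtain ⟨hr0, hr1⟩ := hr
  obtain ⟨hs0, hs1⟩ := hs
  lift r to ℕ using hr0
  lift s to ℕ using hs0
  rw [← Nat.cast_add, altSign_natCast, f]
  norm_cast at hr1 hs1
  split_ifs with hc <;> interval_cases r <;> interval_cases s <;>
    first
    | (exfalso; norm_num at hn; omega)
    | norm_num

theorem coeff_thetaSeries_altSign_one_mul_six (n : ℕ) :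
    coeff n (thetaSeries (altSign (ZMod 3)) 1 * thetaSeries (altSign (ZMod 3)) 6) =
      (f n : ZMod 3) * R16 n := by
  have h := (hasSum_thetaSeries_mul (altSign (ZMod 3)) (altSign (ZMod 3)) one_pos
    (show 0 < 6 by norm_num)).map (coeff n) (continuous_coeff _ n)
  have hfin : {p : ℤ × ℤ | p.1 ^ 2 + 6 * p.2 ^ 2 = (n : ℤ)}.Finite := by
    refine ((finite_natAbs_le n).prod (finite_natAbs_le n)).subset fun p hp ↦ ?_
    have hp' : 1 * p.1.natAbs ^ 2 + 6 * p.2.natAbs ^ 2 = n := by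
      zify
      simpa [sq_abs] using hp
    exact ⟨natAbs_le_of_mul_sq_le one_pos (by omega),
      natAbs_le_of_mul_sq_le (show 0 < 6 by norm_num) (by omega)⟩
  have hterm (p : ℤ × ℤ) : coeff n (monomial (1 * p.1.natAbs ^ 2 + 6 * p.2.natAbs ^ 2)
      (altSign (ZMod 3) p.1 * altSign (ZMod 3) p.2)) =
      if p ∈ hfin.toFinset then (f n : ZMod 3) else 0 := by
    have hiff : n = 1 * p.1.natAbs ^ 2 + 6 * p.2.natAbs ^ 2 ↔
        p.1 ^ 2 + 6 * p.2 ^ 2 = (n : ℤ) := by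
      zify
      simp [sq_abs, eq_comm]
    rw [coeff_monomial]
    simp only [hiff, Set.Finite.mem_toFinset, Set.mem_ofPred_eq]
    split_ifs with hp
    · exact altSign_mul_altSign_of_sq_add_six_mul_sq hp
    · rfl
  have h2 : HasSum (fun p : ℤ × ℤ ↦ if p ∈ hfin.toFinset then (f n : ZMod 3) else 0)
      (∑ p ∈ hfin.toFinset, if p ∈ hfin.toFinset then (f n : ZMod 3) else 0) :=
    hasSum_sum_of_ne_finset_zero fun p hp ↦ if_neg hp
  have hcard : R16 n = hfin.toFinset.card := Nat.card_eq_card_finite_toFinset hfin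
  rw [h.unique (by simpa only [Function.comp_def, hterm] using h2), Finset.sum_ite_mem,
    Finset.inter_self, Finset.sum_const, ← hcard, nsmul_eq_mul, mul_comm]

end CharThree

theorem pbarOdd_three_mul_congr (n : ℕ) :
    (pbarOdd (3 * n) : ℤ) ≡ f n * R16 n [ZMOD 3] := by
  refine (ZMod.intCast_eq_intCast_iff _ _ 3).mp ?_
  have h := congrArg (coeff n) multisection_three_powerSeriesMk_pbarOdd
  rw [coeff_multisection, coeff_mk, coeff_thetaSeries_altSign_one_mul_six] at h
  exact_mod_cast h
end

section
/- For all integers n ≥ 0, the number of partitions of 3n+1 without repeated even parts satisfies ped(3n+1) ≡ (-1)^{n+1}·R(8n+3, 2x²+3y²) (mod 3). -/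
/-- `ped n`: number of partitions of `n` in which even parts are not repeated. -/
noncomputable def ped (n : ℕ) : ℕ :=
  Nat.card {p : n.Partition // ∀ i, Even i → p.parts.count i ≤ 1}

/-- `R(n, 2x² + 3y²)`: number of representations of `n` by `2x² + 3y²`. -/
noncomputable def R23 (n : ℕ) : ℕ := Nat.card {p : ℤ × ℤ // 2 * p.1 ^ 2 + 3 * p.2 ^ 2 = (n : ℤ)}

open PowerSeries Filter Topology
open scoped PowerSeries.WithPiTopology

/-- The generating series of the number of `i : ι` with a prescribed value of `e i`. -/
noncomputable def countSeries (R : Type*) [Semiring R] {ι : Type*} (e : ι → ℕ) : R⟦X⟧ :=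
  PowerSeries.mk fun n ↦ (Nat.card {i // e i = n} : R)

section CountSeries

variable {R : Type*} [CommSemiring R] {ι κ : Type*}

lemma countSeries_comp_bijective {e : ι → ℕ} {f : κ → ℕ} (g : ι → κ) (hg : g.Bijective)
    (h : ∀ i, f (g i) = e i) : countSeries R f = countSeries R e := by
  ext n
  simp only [countSeries, coeff_mk]
  exact congrArg _ (Nat.card_congr ((Equiv.ofBijective g hg).subtypeEquiv fun i ↦ by simp [h])).symm

lemma countSeries_sumElim {e : ι → ℕ} {f : κ → ℕ} (he : ∀ n, {i | e i = n}.Finite)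
    (hf : ∀ n, {i | f i = n}.Finite) :
    countSeries R (Sum.elim e f) = countSeries R e + countSeries R f := by
  ext n
  have : Finite {a // Sum.elim e f (Sum.inl a) = n} := (he n).to_subtype
  have : Finite {b // Sum.elim e f (Sum.inr b) = n} := (hf n).to_subtype
  simp only [countSeries, coeff_mk, map_add]
  rw [← Nat.cast_add, Nat.card_congr (Equiv.subtypeSum (α := ι) (β := κ))]
  exact congrArg _ Nat.card_sum

lemma countSeries_mul {e : ι → ℕ} {f : κ → ℕ} (he : ∀ n, {i | e i = n}.Finite)
    (hf : ∀ n, {i | f i = n}.Finite) :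
    countSeries R e * countSeries R f = countSeries R fun p : ι × κ ↦ e p.1 + f p.2 := by
  ext n
  simp only [countSeries, coeff_mk, coeff_mul]
  let g : {p : ι × κ // e p.1 + f p.2 = n} ≃
      Σ a : Finset.HasAntidiagonal.antidiagonal n, {i // e i = a.1.1} × {j // f j = a.1.2} :=
    { toFun := fun p ↦ ⟨⟨(e p.1.1, f p.1.2), by simpa using p.2⟩, ⟨p.1.1, rfl⟩, ⟨p.1.2, rfl⟩⟩
      invFun := fun q ↦ ⟨(q.2.1.1, q.2.2.1), by
        rw [q.2.1.2, q.2.2.2]; exact Finset.HasAntidiagonal.mem_antidiagonal.1 q.1.2⟩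
      left_inv := fun p ↦ rfl
      right_inv := by
        rintro ⟨⟨⟨a, b⟩, hab⟩, ⟨i, hi⟩, ⟨j, hj⟩⟩
        change e i = a at hi
        change f j = b at hj
        subst hi hj
        rfl }
  have (a : Finset.HasAntidiagonal.antidiagonal n) :
      Finite ({i // e i = a.1.1} × {j // f j = a.1.2}) :=
    @Finite.instProd _ _ ((he _).to_subtype) ((hf _).to_subtype)
  rw [Nat.card_congr g, Nat.card_sigma]
  simp only [Nat.card_prod]
  rw [Finset.sum_coe_sort (Finset.HasAntidiagonal.antidiagonal n)
    (fun a ↦ Nat.card {i // e i = a.1} * Nat.card {j // f j = a.2})]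
  push_cast
  rfl

end CountSeries

section CountSeriesRing

variable {R : Type*} [CommRing R] {ι : Type*}

lemma countSeries_const_mul {k : ℕ} (hk : k ≠ 0) (e : ι → ℕ) :
    countSeries R (fun i ↦ k * e i) = expand k hk (countSeries R e) := by
  ext n
  rw [coeff_expand]
  simp only [countSeries, coeff_mk]
  split_ifs with h
  · obtain ⟨m, rfl⟩ := h
    rw [Nat.mul_div_cancel_left _ (Nat.pos_of_ne_zero hk)]
    simp [hk]
  · have : IsEmpty {i // k * e i = n} := ⟨fun i ↦ h ⟨_, i.2.symm⟩⟩
    simp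

lemma countSeries_add_one (e : ι → ℕ) :
    countSeries R (fun i ↦ e i + 1) = X * countSeries R e := by
  ext n
  rcases n with _ | n
  · simp [countSeries]
  · simp [countSeries, coeff_succ_X_mul]

end CountSeriesRing

lemma expand_three_eq_pow (F : (ZMod 3)⟦X⟧) : expand 3 (by norm_num) F = F ^ 3 := by
  have h := MvPowerSeries.map_frobenius_expand 3 (by norm_num) (f := F)
  rw [ZMod.frobenius_zmod] at h
  exact (congrFun (congrArg DFunLike.coe MvPowerSeries.map_id) _).symm.trans h

section ThirdPart

variable {R : Type*} [CommRing R]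

/-- The series of the coefficients of index `1` modulo `3`. -/
noncomputable def thirdPart (R : Type*) [CommRing R] : R⟦X⟧ →+ R⟦X⟧ where
  toFun F := PowerSeries.mk fun n ↦ coeff (3 * n + 1) F
  map_zero' := by ext; simp
  map_add' F G := by ext; simp

lemma coeff_thirdPart (F : R⟦X⟧) (n : ℕ) :
    coeff n (thirdPart R F) = coeff (3 * n + 1) F := by
  simp [thirdPart]

lemma thirdPart_mul_expand (F G : R⟦X⟧) :
    thirdPart R (F * expand 3 (by norm_num) G) = thirdPart R F * G := by
  ext n
  rw [coeff_thirdPart, coeff_mul, coeff_mul]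
  symm
  refine Finset.sum_of_injOn (fun p ↦ (3 * p.1 + 1, 3 * p.2)) ?_ ?_ ?_ ?_
  · rintro ⟨a, b⟩ _ ⟨c, d⟩ _ h
    simp only [Prod.mk.injEq] at h ⊢
    lia
  · rintro ⟨a, b⟩ h
    simp only [Finset.mem_coe, Finset.HasAntidiagonal.mem_antidiagonal] at h ⊢
    lia
  · rintro ⟨a, b⟩ h h'
    rw [coeff_expand]
    split_ifs with hb
    · obtain ⟨c, rfl⟩ := hb
      rw [Finset.HasAntidiagonal.mem_antidiagonal] at h
      refine absurd ⟨(n - c, c), ?_, ?_⟩ h'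
      · simp
        lia
      · simp
        lia
    · simp
  · rintro ⟨a, b⟩ _
    rw [coeff_thirdPart, coeff_expand_mul]

lemma thirdPart_expand (G : R⟦X⟧) : thirdPart R (expand 3 (by norm_num) G) = 0 := by
  ext n
  rw [coeff_thirdPart, coeff_expand_of_not_dvd _ _ _ (by lia), map_zero]

lemma thirdPart_X_mul_expand (G : R⟦X⟧) :
    thirdPart R (X * expand 3 (by norm_num) G) = G := by
  ext n
  rw [coeff_thirdPart, coeff_succ_X_mul, coeff_expand_mul]

lemma thirdPart_X_sq_mul_expand (G : R⟦X⟧) :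
    thirdPart R (X ^ 2 * expand 3 (by norm_num) G) = 0 := by
  ext n
  rw [coeff_thirdPart, pow_two, mul_assoc, coeff_succ_X_mul]
  rcases n with _ | n
  · simp
  · rw [show 3 * (n + 1) = 3 * n + 2 + 1 by ring, coeff_succ_X_mul,
      coeff_expand_of_not_dvd _ _ _ (by lia), map_zero]

end ThirdPart

section ThetaExponents

/-- The square of an integer, as a natural number. -/
def sqExp (k : ℤ) : ℕ := (k ^ 2).toNat

/-- The triangular number `k (k + 1) / 2`. -/
def triExp (k : ℤ) : ℕ := (k * (k + 1) / 2).toNat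

/-- The exponents of the theta series obtained from the squares of the integers `3 k + 1`. -/
def sqResExp (k : ℤ) : ℕ := (3 * k ^ 2 + 2 * k).toNat

/-- The generalized pentagonal number `k (3 k + 1) / 2`. -/
def pentExp (k : ℤ) : ℕ := (k * (3 * k + 1) / 2).toNat

lemma abs_le_mul_self (k : ℤ) : |k| ≤ k * k := by
  have := abs_mul_abs_self k
  rcases (abs_nonneg k).eq_or_lt with h | h <;> nlinarith

lemma coe_sqExp (k : ℤ) : (sqExp k : ℤ) = k ^ 2 := Int.toNat_of_nonneg (sq_nonneg k)

lemma two_mul_triExp (k : ℤ) : 2 * (triExp k : ℤ) = k * (k + 1) := by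
  obtain ⟨c, hc⟩ := (Int.even_mul_succ_self k).two_dvd
  have := abs_le_mul_self k
  have : 0 ≤ k * (k + 1) := by linarith [neg_abs_le k]
  rw [triExp]
  lia

lemma coe_sqResExp (k : ℤ) : (sqResExp k : ℤ) = 3 * k ^ 2 + 2 * k :=
  Int.toNat_of_nonneg (by nlinarith [abs_le_mul_self k, neg_abs_le k])

lemma two_mul_pentExp (k : ℤ) : 2 * (pentExp k : ℤ) = k * (3 * k + 1) := by
  obtain ⟨c, hc⟩ : 2 ∣ k * (3 * k + 1) := by
    obtain ⟨c, hc⟩ := (Int.even_mul_succ_self k).two_dvd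
    exact ⟨c + k * k, by linarith⟩
  have := abs_le_mul_self k
  have : 0 ≤ k * (3 * k + 1) := by linarith [neg_abs_le k, abs_nonneg k]
  rw [pentExp]
  lia

lemma finite_setOf_le_of_abs_le {e : ℤ → ℕ} (h : ∀ k, |k| ≤ e k + 1) (n : ℕ) :
    {k | e k ≤ n}.Finite :=
  (Set.finite_Icc (-(n + 1) : ℤ) (n + 1)).subset fun k (hk : e k ≤ n) ↦
    abs_le.1 ((h k).trans (by exact_mod_cast Nat.succ_le_succ hk))

lemma abs_le_sqExp (k : ℤ) : |k| ≤ sqExp k + 1 := by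
  rw [coe_sqExp]
  linarith [abs_le_mul_self k]

lemma abs_le_triExp (k : ℤ) : |k| ≤ triExp k + 1 := by
  have := two_mul_triExp k
  have := abs_le_mul_self (|k| - 1)
  linarith [neg_abs_le k, abs_mul_abs_self k, le_abs_self (|k| - 1)]

lemma abs_le_sqResExp (k : ℤ) : |k| ≤ sqResExp k + 1 := by
  rw [coe_sqResExp]
  linarith [abs_le_mul_self k, neg_abs_le k]

lemma abs_le_pentExp (k : ℤ) : |k| ≤ pentExp k + 1 := by
  linarith [abs_le_mul_self k, neg_abs_le k, two_mul_pentExp k]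

lemma finite_fiber_of_abs_le {e : ℤ → ℕ} (h : ∀ k, |k| ≤ e k + 1) (n : ℕ) :
    {k | e k = n}.Finite :=
  (finite_setOf_le_of_abs_le h n).subset fun _ hk ↦ le_of_eq hk

lemma abs_le_const_mul {e : ℤ → ℕ} (h : ∀ k, |k| ≤ e k + 1) {c : ℕ} (hc : c ≠ 0) (k : ℤ) :
    |k| ≤ ((c * e k : ℕ) : ℤ) + 1 :=
  (h k).trans (by gcongr; exact Nat.le_mul_of_pos_left _ (Nat.pos_of_ne_zero hc))

lemma finite_fiber_add {ι κ : Type*} {e : ι → ℕ} {f : κ → ℕ} (he : ∀ n, {i | e i ≤ n}.Finite)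
    (hf : ∀ n, {i | f i ≤ n}.Finite) (n : ℕ) : {p : ι × κ | e p.1 + f p.2 = n}.Finite :=
  ((he n).prod (hf n)).subset fun p (hp : _ = n) ↦
    ⟨show e p.1 ≤ n by lia, show f p.2 ≤ n by lia⟩

end ThetaExponents

section ThetaIdentities

variable (R : Type*) [CommRing R]

/-- `∑ q ^ (k ^ 2)` over the integers `k`. -/
noncomputable def thetaSq : R⟦X⟧ := countSeries R sqExp

/-- `∑ q ^ (k (k + 1) / 2)` over the integers `k`. -/
noncomputable def thetaTri : R⟦X⟧ := countSeries R triExp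

lemma thetaTri_sq :
    thetaTri R ^ 2 = 2 * thetaSq R * expand 2 (by norm_num) (thetaTri R) := by
  have h2 := finite_setOf_le_of_abs_le (abs_le_const_mul abs_le_triExp (c := 2) (by norm_num))
  have hsq := finite_setOf_le_of_abs_le abs_le_sqExp
  have htri := finite_fiber_of_abs_le abs_le_triExp
  rw [pow_two, thetaTri, thetaSq, ← countSeries_const_mul, mul_assoc, two_mul,
    countSeries_mul htri htri, countSeries_mul (finite_fiber_of_abs_le abs_le_sqExp)
    (finite_fiber_of_abs_le (abs_le_const_mul abs_le_triExp (by norm_num))),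
    ← countSeries_sumElim (finite_fiber_add hsq h2) (finite_fiber_add hsq h2)]
  refine countSeries_comp_bijective (Sum.elim (fun p ↦ (p.2 + p.1, p.2 - p.1))
    fun p ↦ (-1 - (p.2 + p.1), p.2 - p.1)) ⟨?_, ?_⟩ ?_
  · rintro (⟨a, b⟩ | ⟨a, b⟩) (⟨c, d⟩ | ⟨c, d⟩) h <;>
      simp only [Sum.elim_inl, Sum.elim_inr, Prod.mk.injEq, Sum.inl.injEq, Sum.inr.injEq,
        reduceCtorEq] at h ⊢ <;> lia
  · rintro ⟨s, t⟩
    rcases Int.emod_two_eq_zero_or_one (s + t) with h | h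
    · exact ⟨.inl ((s - t) / 2, (s + t) / 2), by
        simp only [Sum.elim_inl, Prod.mk.injEq]; lia⟩
    · exact ⟨.inr ((-1 - s - t) / 2, (-1 - s + t) / 2), by
        simp only [Sum.elim_inr, Prod.mk.injEq]; lia⟩
  · rintro (⟨a, b⟩ | ⟨a, b⟩) <;> simp only [Sum.elim_inl, Sum.elim_inr] <;> zify
    · linarith [two_mul_triExp (b + a), two_mul_triExp (b - a), two_mul_triExp b, coe_sqExp a]
    · linarith [two_mul_triExp (-1 - (b + a)), two_mul_triExp (b - a), two_mul_triExp b,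
        coe_sqExp a]

lemma thetaSq_trisection :
    thetaSq R = expand 3 (by norm_num) (expand 3 (by norm_num) (thetaSq R)) +
      2 * X * expand 3 (by norm_num) (countSeries R sqResExp) := by
  have h1 := finite_fiber_of_abs_le (abs_le_const_mul (abs_le_const_mul abs_le_sqExp (c := 3)
    (by norm_num)) (c := 3) (by norm_num))
  have h2 := finite_fiber_of_abs_le (e := fun k ↦ 3 * sqResExp k + 1) (fun k ↦
    (abs_le_const_mul abs_le_sqResExp (c := 3) (by norm_num) k).trans (by simp))
  rw [thetaSq, ← countSeries_const_mul, ← countSeries_const_mul, ← countSeries_const_mul,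
    mul_assoc, ← countSeries_add_one, two_mul, ← countSeries_sumElim h2 h2,
    ← countSeries_sumElim h1]
  swap
  · exact fun n ↦ ((h2 n).image Sum.inl |>.union ((h2 n).image Sum.inr)).subset (by
      rintro (k | k) hk
      · exact .inl ⟨k, hk, rfl⟩
      · exact .inr ⟨k, hk, rfl⟩)
  refine countSeries_comp_bijective (Sum.elim (fun k ↦ 3 * k)
    (Sum.elim (fun k ↦ 3 * k + 1) fun k ↦ -(3 * k + 1))) ⟨?_, ?_⟩ ?_
  · rintro (a | a | a) (b | b | b) h <;>
      simp only [Sum.elim_inl, Sum.elim_inr, Sum.inl.injEq, Sum.inr.injEq,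
        reduceCtorEq] at h ⊢ <;> lia
  · intro k
    rcases (by lia : k % 3 = 0 ∨ k % 3 = 1 ∨ k % 3 = 2) with h | h | h
    · exact ⟨.inl (k / 3), by simp only [Sum.elim_inl]; lia⟩
    · exact ⟨.inr (.inl (k / 3)), by simp only [Sum.elim_inl, Sum.elim_inr]; lia⟩
    · exact ⟨.inr (.inr ((-1 - k) / 3)), by simp only [Sum.elim_inr]; lia⟩
  · rintro (a | a | a) <;> simp only [Sum.elim_inl, Sum.elim_inr] <;> zify
    · linarith [coe_sqExp (3 * a), coe_sqExp a]
    · linarith [coe_sqExp (3 * a + 1), coe_sqResExp a]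
    · linarith [coe_sqExp (-(3 * a + 1)), coe_sqResExp a]

lemma thetaTri_trisection :
    thetaTri R = 2 * expand 3 (by norm_num) (countSeries R pentExp) +
      X * expand 3 (by norm_num) (expand 3 (by norm_num) (thetaTri R)) := by
  have h1 := finite_fiber_of_abs_le (abs_le_const_mul abs_le_pentExp (c := 3) (by norm_num))
  have h2 := finite_fiber_of_abs_le (e := fun k ↦ 3 * (3 * triExp k) + 1) (fun k ↦
    (abs_le_const_mul (abs_le_const_mul abs_le_triExp (c := 3) (by norm_num)) (c := 3)
      (by norm_num) k).trans (by simp))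
  rw [thetaTri, ← countSeries_const_mul, ← countSeries_const_mul, ← countSeries_const_mul,
    ← countSeries_add_one, two_mul, ← countSeries_sumElim h1 h1, ← countSeries_sumElim _ h2]
  swap
  · exact fun n ↦ ((h1 n).image Sum.inl |>.union ((h1 n).image Sum.inr)).subset (by
      rintro (k | k) hk
      · exact .inl ⟨k, hk, rfl⟩
      · exact .inr ⟨k, hk, rfl⟩)
  refine countSeries_comp_bijective (Sum.elim
    (Sum.elim (fun k ↦ 3 * k) fun k ↦ -1 - 3 * k) fun k ↦ 3 * k + 1) ⟨?_, ?_⟩ ?_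
  · rintro ((a | a) | a) ((b | b) | b) h <;>
      simp only [Sum.elim_inl, Sum.elim_inr, Sum.inl.injEq, Sum.inr.injEq,
        reduceCtorEq] at h ⊢ <;> lia
  · intro k
    rcases (by lia : k % 3 = 0 ∨ k % 3 = 1 ∨ k % 3 = 2) with h | h | h
    · exact ⟨.inl (.inl (k / 3)), by simp only [Sum.elim_inl]; lia⟩
    · exact ⟨.inr (k / 3), by simp only [Sum.elim_inr]; lia⟩
    · exact ⟨.inl (.inr ((-1 - k) / 3)), by simp only [Sum.elim_inl, Sum.elim_inr]; lia⟩
  · rintro ((a | a) | a) <;> simp only [Sum.elim_inl, Sum.elim_inr] <;> zify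
    · linarith [two_mul_triExp (3 * a), two_mul_pentExp a]
    · linarith [two_mul_triExp (-1 - 3 * a), two_mul_pentExp a]
    · linarith [two_mul_triExp (3 * a + 1), two_mul_triExp a]

lemma thetaTri_mul_expand_two :
    thetaTri R * expand 2 (by norm_num) (thetaTri R) =
      2 * (countSeries R sqResExp * countSeries R pentExp) +
        expand 3 (by norm_num) (thetaTri R) * expand 3 (by norm_num) (thetaSq R) := by
  have hr := finite_setOf_le_of_abs_le abs_le_sqResExp
  have hp := finite_setOf_le_of_abs_le abs_le_pentExp
  have ht3 := abs_le_const_mul abs_le_triExp (c := 3) (by norm_num)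
  have hs3 := abs_le_const_mul abs_le_sqExp (c := 3) (by norm_num)
  have h1 := finite_fiber_add hr hp
  have h2 := finite_fiber_add (finite_setOf_le_of_abs_le ht3) (finite_setOf_le_of_abs_le hs3)
  rw [thetaTri, thetaSq, ← countSeries_const_mul, ← countSeries_const_mul,
    ← countSeries_const_mul, countSeries_mul (finite_fiber_of_abs_le abs_le_triExp)
    (finite_fiber_of_abs_le (abs_le_const_mul abs_le_triExp (by norm_num))),
    countSeries_mul (finite_fiber_of_abs_le abs_le_sqResExp)
    (finite_fiber_of_abs_le abs_le_pentExp), countSeries_mul (finite_fiber_of_abs_le ht3)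
    (finite_fiber_of_abs_le hs3), two_mul, ← countSeries_sumElim h1 h1,
    ← countSeries_sumElim _ h2]
  swap
  · exact fun n ↦ ((h1 n).image Sum.inl |>.union ((h1 n).image Sum.inr)).subset (by
      rintro (k | k) hk
      · exact .inl ⟨k, hk, rfl⟩
      · exact .inr ⟨k, hk, rfl⟩)
  refine countSeries_comp_bijective (Sum.elim
    (Sum.elim (fun p ↦ (p.2 - 2 * p.1 - 1, p.2 + p.1)) fun p ↦ (2 * p.1 - p.2, -1 - p.2 - p.1))
    fun p ↦ (p.1 + 2 * p.2, p.1 - p.2)) ⟨?_, ?_⟩ ?_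
  · rintro ((⟨a, b⟩ | ⟨a, b⟩) | ⟨a, b⟩) ((⟨c, d⟩ | ⟨c, d⟩) | ⟨c, d⟩) h <;>
      simp only [Sum.elim_inl, Sum.elim_inr, Sum.inl.injEq, Sum.inr.injEq, Prod.mk.injEq,
        reduceCtorEq] at h ⊢ <;> lia
  · rintro ⟨k, l⟩
    rcases (by lia : (k - l) % 3 = 0 ∨ (k - l) % 3 = 1 ∨ (k - l) % 3 = 2) with h | h | h
    · exact ⟨.inr ((k + 2 * l) / 3, (k - l) / 3), by
        simp only [Sum.elim_inr, Prod.mk.injEq]; lia⟩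
    · exact ⟨.inl (.inr ((k - l - 1) / 3, (-k - 2 * l - 2) / 3)), by
        simp only [Sum.elim_inl, Sum.elim_inr, Prod.mk.injEq]; lia⟩
    · exact ⟨.inl (.inl ((l - k - 1) / 3, (k + 2 * l + 1) / 3)), by
        simp only [Sum.elim_inl, Prod.mk.injEq]; lia⟩
  · rintro ((⟨a, b⟩ | ⟨a, b⟩) | ⟨a, b⟩) <;> simp only [Sum.elim_inl, Sum.elim_inr] <;> zify
    · linarith [two_mul_triExp (b - 2 * a - 1), two_mul_triExp (b + a), coe_sqResExp a,
        two_mul_pentExp b]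
    · linarith [two_mul_triExp (2 * a - b), two_mul_triExp (-1 - b - a), coe_sqResExp a,
        two_mul_pentExp b]
    · linarith [two_mul_triExp (a + 2 * b), two_mul_triExp (a - b), two_mul_triExp a,
        coe_sqExp b]

end ThetaIdentities

lemma thirdPart_thetaTri_mul_thetaSq_sq :
    thirdPart (ZMod 3) (thetaTri (ZMod 3) * thetaSq (ZMod 3) ^ 2) =
      -(thetaSq (ZMod 3) ^ 2 * thetaTri (ZMod 3) ^ 3) := by
  set φ := thetaSq (ZMod 3) with hφ
  set ψ := thetaTri (ZMod 3) with hψ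
  set E := expand (R := ZMod 3) 3 (by norm_num) with hE
  set r := countSeries (ZMod 3) sqResExp
  set p := countSeries (ZMod 3) pentExp
  have h3 : (3 : (ZMod 3)⟦X⟧) = 0 := by
    rw [← map_ofNat (C (R := ZMod 3)) 3]
    exact map_zero C
  have hpow (F : (ZMod 3)⟦X⟧) : E F = F ^ 3 := expand_three_eq_pow F
  have hd : ψ * φ ^ 2 = E (2 * p * E φ ^ 2 + X * (4 * E ψ * r ^ 2 )) +
      X * E (8 * p * r * E φ + E ψ * E φ ^ 2) +
      X ^ 2 * E (8 * p * r ^ 2 + 4 * r * E φ * E ψ) := by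
    have hX : E X = X ^ 3 := expand_X ..
    have h2 : E 2 = 2 := map_ofNat E 2
    have h4 : E 4 = 4 := map_ofNat E 4
    have h8 : E 8 = 8 := map_ofNat E 8
    simp only [map_add, map_mul, map_pow, hX, h2, h4, h8]
    conv_lhs => rw [hφ, hψ, thetaTri_trisection, thetaSq_trisection]
    ring
  rw [hd, map_add, map_add, thirdPart_expand, thirdPart_X_mul_expand, thirdPart_X_sq_mul_expand,
    zero_add, add_zero]
  have h1 := thetaTri_mul_expand_two (ZMod 3)
  have h2 := thetaTri_sq (ZMod 3)
  simp only [← hE, ← hφ, ← hψ] at h1 h2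
  simp only [hpow] at h1 ⊢
  linear_combination (-4 * φ ^ 3) * h1 - 2 * φ ^ 2 * ψ * h2 +
    (φ ^ 2 * ψ ^ 3 - ψ ^ 3 * φ ^ 6) * h3

/-- The reciprocal of `(q; q)_k` at `q = X ^ d`, read as `0` when `k < 0`. -/
noncomputable def invPoch (R : Type*) [Field R] (d : ℕ) (k : ℤ) : R⟦X⟧ :=
  if 0 ≤ k then ∏ i ∈ Finset.range k.toNat, (1 - X ^ (d * (i + 1)))⁻¹ else 0

section JacobiTriple

variable {R : Type*} [Field R]

lemma invPoch_natCast (d k : ℕ) :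
    invPoch R d k = ∏ i ∈ Finset.range k, (1 - X ^ (d * (i + 1)))⁻¹ := by
  simp [invPoch]

lemma invPoch_of_neg {d : ℕ} {k : ℤ} (hk : k < 0) : invPoch R d k = 0 := by
  simp [invPoch, hk]

lemma one_sub_X_pow_mul_inv {k : ℕ} (hk : k ≠ 0) :
    (1 - X ^ k : R⟦X⟧) * (1 - X ^ k)⁻¹ = 1 :=
  PowerSeries.mul_inv_cancel _ (by simp [hk])

lemma invPoch_sub_one {d : ℕ} (hd : d ≠ 0) (k : ℕ) :
    invPoch R d ((k : ℤ) - 1) = (1 - X ^ (d * k)) * invPoch R d k := by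
  rcases k with _ | k
  · simp [invPoch]
  · have h : (((k + 1 : ℕ) : ℤ) - 1) = (k : ℤ) := by push_cast; ring
    rw [h, invPoch_natCast, invPoch_natCast, Finset.prod_range_succ, mul_left_comm,
      one_sub_X_pow_mul_inv (by positivity), mul_one]

/-- The bilateral sum in the finite form of the Jacobi triple product. -/
noncomputable def finiteTheta (R : Type*) [Field R] (d : ℕ) (e : ℤ → ℕ) (m n : ℕ) : R⟦X⟧ :=
  ∑ᶠ j : ℤ, invPoch R d (m - j) * invPoch R d (n + j) * X ^ e j

lemma finite_support_finiteTheta (d : ℕ) (e : ℤ → ℕ) (m n : ℤ) :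
    (Function.support fun j : ℤ ↦
      invPoch R d (m - j) * invPoch R d (n + j) * X ^ e j).Finite := by
  refine (Set.finite_Icc (-n) m).subset fun j hj ↦ ?_
  by_contra h
  apply hj
  rcases (by simp only [Set.mem_Icc] at h; lia : m - j < 0 ∨ n + j < 0) with h | h <;>
    simp [invPoch_of_neg h]

lemma finiteTheta_succ_left {d α : ℕ} (hd : d ≠ 0) {e : ℤ → ℕ}
    (he : ∀ j, (e (j + 1) : ℤ) = e j + α + d * j) (m n : ℕ) :
    (1 - X ^ (d * (m + n + 1))) * finiteTheta R d e (m + 1) n =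
      (1 + X ^ (α + d * m)) * finiteTheta R d e m n := by
  have hs := finite_support_finiteTheta (R := R) d e m n
  have hs' : (Function.support fun j : ℤ ↦ invPoch R d (m - (j - 1)) *
      invPoch R d (n + (j - 1)) * X ^ e (j - 1)).Finite :=
    hs.preimage (f := fun j : ℤ ↦ j - 1) (by intro a _ b _ h; simpa using h)
  have hshift : finiteTheta R d e m n = ∑ᶠ j : ℤ, invPoch R d (m - (j - 1)) *
      invPoch R d (n + (j - 1)) * X ^ e (j - 1) :=
    (finsum_comp_equiv (Equiv.subRight (1 : ℤ))).symm
  rw [add_mul (1 : R⟦X⟧), one_mul]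
  nth_rw 2 [hshift]
  rw [finiteTheta, finiteTheta, mul_finsum, mul_finsum, ← finsum_add_distrib hs]
  · refine finsum_congr fun j ↦ ?_
    by_cases hA : 0 ≤ (m : ℤ) + 1 - j
    swap
    · rw [invPoch_of_neg (k := ((m + 1 : ℕ) : ℤ) - j) (by push_cast; lia),
        invPoch_of_neg (k := (m : ℤ) - j) (by lia),
        invPoch_of_neg (k := (m : ℤ) - (j - 1)) (by lia)]
      simp
    by_cases hB : 0 ≤ (n : ℤ) + j
    swap
    · rw [invPoch_of_neg (k := (n : ℤ) + j) (by lia),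
        invPoch_of_neg (k := (n : ℤ) + (j - 1)) (by lia)]
      simp
    obtain ⟨A, hA'⟩ := Int.eq_ofNat_of_zero_le hA
    obtain ⟨B, hB'⟩ := Int.eq_ofNat_of_zero_le hB
    have h1 : (((m + 1 : ℕ) : ℤ) - j) = A := by push_cast; lia
    have h2 : (m : ℤ) - j = A - 1 := by lia
    have h3 : (m : ℤ) - (j - 1) = A := by lia
    have h4 : (n : ℤ) + (j - 1) = B - 1 := by lia
    have hAB : m + n + 1 = A + B := by lia
    have hexp : α + d * m + e (j - 1) = d * A + e j := by
      have := he (j - 1)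
      rw [sub_add_cancel] at this
      zify
      rw [← hA', this]
      ring
    have hX : (X : R⟦X⟧) ^ (α + d * m) * X ^ e (j - 1) = X ^ (d * A) * X ^ e j := by
      rw [← pow_add, ← pow_add, hexp]
    rw [h1, h2, h3, h4, hB', invPoch_sub_one hd, invPoch_sub_one hd, hAB, mul_add d, pow_add]
    linear_combination (-invPoch R d A * invPoch R d B * (1 - X ^ (d * B))) * hX
  · exact hs'.subset (Function.support_mul_subset_right _ _)

lemma finiteTheta_swap (d : ℕ) (e : ℤ → ℕ) (m n : ℕ) :
    finiteTheta R d e m n = finiteTheta R d (fun j ↦ e (-j)) n m := by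
  rw [finiteTheta, finiteTheta, ← finsum_comp_equiv (Equiv.neg ℤ)]
  refine finsum_congr fun j ↦ ?_
  rw [Equiv.neg_apply, sub_neg_eq_add, ← sub_eq_add_neg, mul_comm (invPoch R d (m + j))]

lemma finiteTheta_succ_right {d α β : ℕ} (hd : d ≠ 0) (hαβ : α + β = d) {e : ℤ → ℕ}
    (he : ∀ j, (e (j + 1) : ℤ) = e j + α + d * j) (m n : ℕ) :
    (1 - X ^ (d * (m + n + 1))) * finiteTheta R d e m (n + 1) =
      (1 + X ^ (β + d * n)) * finiteTheta R d e m n := by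
  have he' (j : ℤ) : ((fun i ↦ e (-i)) (j + 1) : ℤ) =
      (fun i ↦ e (-i)) j + β + d * j := by
    have := he (-(j + 1))
    rw [show -(j + 1) + 1 = -j by ring, ← hαβ] at this
    push_cast at this ⊢
    simp only [← hαβ, this]
    push_cast
    ring
  have := finiteTheta_succ_left (R := R) (e := fun i ↦ e (-i)) hd he' n m
  rw [finiteTheta_swap _ e, finiteTheta_swap _ e, add_comm m n, this]

lemma finiteTheta_zero_zero (d : ℕ) {e : ℤ → ℕ} (he0 : e 0 = 0) :
    finiteTheta R d e 0 0 = 1 := by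
  rw [finiteTheta, finsum_eq_single _ 0]
  · simp [invPoch, he0]
  · intro j hj
    rcases hj.lt_or_gt with h | h
    · rw [invPoch_of_neg (k := ((0 : ℕ) : ℤ) + j) (by simpa)]; simp
    · rw [invPoch_of_neg (k := ((0 : ℕ) : ℤ) - j) (by simpa)]; simp

lemma prod_eq_finiteTheta {d α β : ℕ} (hd : d ≠ 0) (hαβ : α + β = d) {e : ℤ → ℕ} (he0 : e 0 = 0)
    (he : ∀ j, (e (j + 1) : ℤ) = e j + α + d * j) (m : ℕ) :
    ∏ i ∈ Finset.range m, (1 + X ^ (α + d * i)) * (1 + X ^ (β + d * i)) =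
      (∏ i ∈ Finset.range (2 * m), (1 - X ^ (d * (i + 1)))) *
        finiteTheta R d e m m := by
  induction m with
  | zero => simp [finiteTheta_zero_zero _ he0]
  | succ m ih =>
    rw [Finset.prod_range_succ, ih, show 2 * (m + 1) = 2 * m + 1 + 1 by ring,
      Finset.prod_range_succ, Finset.prod_range_succ]
    have h1 := finiteTheta_succ_left (R := R) hd he m m
    have h2 := finiteTheta_succ_right (R := R) hd hαβ he (m + 1) m
    rw [show m + 1 + m + 1 = 2 * m + 1 + 1 by ring] at h2
    rw [show m + m + 1 = 2 * m + 1 by ring] at h1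
    linear_combination (-(∏ i ∈ Finset.range (2 * m), (1 - X ^ (d * (i + 1)))) *
      (1 - X ^ (d * (2 * m + 1)))) * h2 -
      (∏ i ∈ Finset.range (2 * m), (1 - X ^ (d * (i + 1)))) *
      (1 + X ^ (β + d * m)) * h1

variable [TopologicalSpace R]

lemma multipliable_one_sub_X_pow_mul {d : ℕ} (hd : d ≠ 0) :
    Multipliable fun i : ℕ ↦ (1 - X ^ (d * (i + 1)) : R⟦X⟧) := by
  simp_rw [sub_eq_add_neg]
  apply WithPiTopology.multipliable_one_add_of_tendsto_order_atTop_nhds_top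
  refine ENat.tendsto_nhds_top_iff_natCast_lt.mpr fun n ↦ eventually_atTop.mpr ⟨n, fun m hm ↦ ?_⟩
  rw [order_neg, order_X_pow]
  have := Nat.le_mul_of_pos_left (m + 1) (Nat.pos_of_ne_zero hd)
  exact_mod_cast (by lia : n < d * (m + 1))

lemma multipliable_inv_one_sub_X_pow_mul {d : ℕ} (hd : d ≠ 0) :
    Multipliable fun i : ℕ ↦ ((1 - X ^ (d * (i + 1)))⁻¹ : R⟦X⟧) := by
  have h (i : ℕ) : ((1 - X ^ (d * (i + 1)))⁻¹ : R⟦X⟧) =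
      1 + X ^ (d * (i + 1)) * (1 - X ^ (d * (i + 1)))⁻¹ := by
    linear_combination one_sub_X_pow_mul_inv (R := R) (k := d * (i + 1)) (by positivity)
  simp_rw [funext h]
  apply WithPiTopology.multipliable_one_add_of_tendsto_order_atTop_nhds_top
  refine ENat.tendsto_nhds_top_iff_natCast_lt.mpr fun n ↦ eventually_atTop.mpr ⟨n, fun m hm ↦ ?_⟩
  refine lt_of_lt_of_le ?_ (le_order_mul ..)
  rw [order_X_pow]
  have := Nat.le_mul_of_pos_left (m + 1) (Nat.pos_of_ne_zero hd)
  exact lt_of_lt_of_le (by exact_mod_cast (by lia : n < d * (m + 1))) le_self_add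

lemma tendsto_invPoch {d : ℕ} (hd : d ≠ 0) {f : ℕ → ℤ} (hf : Tendsto f atTop atTop) :
    Tendsto (fun m ↦ invPoch R d (f m)) atTop
      (𝓝 (∏' i : ℕ, (1 - X ^ (d * (i + 1)))⁻¹)) := by
  have hnat : Tendsto (fun m ↦ (f m).toNat) atTop atTop :=
    tendsto_atTop.2 fun b ↦ (tendsto_atTop.1 hf b).mono fun m hm ↦ by lia
  refine ((multipliable_inv_one_sub_X_pow_mul hd).hasProd.tendsto_prod_nat.comp hnat).congr' ?_
  filter_upwards [tendsto_atTop.1 hf 0] with m hm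
  simp [invPoch, hm]

/-- The Jacobi triple product identity, with monomials in place of the two variables. -/
theorem tendsto_jacobi_triple_product [IsTopologicalRing R] [T2Space R] {d α β : ℕ}
    (hd : d ≠ 0) (hαβ : α + β = d) {e : ℤ → ℕ} (he0 : e 0 = 0)
    (he : ∀ j, (e (j + 1) : ℤ) = e j + α + d * j)
    (hfin : ∀ n, {j | e j ≤ n}.Finite) :
    Tendsto (fun m ↦ ∏ i ∈ Finset.range m, (1 - X ^ (d * (i + 1))) *
      ((1 + X ^ (α + d * i)) * (1 + X ^ (β + d * i)))) atTop (𝓝 (countSeries R e)) := by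
  simp_rw [Finset.prod_mul_distrib,
    ← Finset.prod_mul_distrib (f := fun i : ℕ ↦ (1 + X ^ (α + d * i) : R⟦X⟧)),
    prod_eq_finiteTheta (R := R) hd hαβ he0 he]
  set P : ℕ → R⟦X⟧ := fun m ↦ ∏ i ∈ Finset.range m, (1 - X ^ (d * (i + 1)))
  have hP : Tendsto P atTop (𝓝 (∏' i : ℕ, (1 - X ^ (d * (i + 1))))) :=
    (multipliable_one_sub_X_pow_mul hd).hasProd.tendsto_prod_nat
  have hPU : (∏' i : ℕ, (1 - X ^ (d * (i + 1)) : R⟦X⟧)) *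
      ∏' i : ℕ, (1 - X ^ (d * (i + 1)))⁻¹ = 1 := by
    rw [← (multipliable_one_sub_X_pow_mul hd).tprod_mul (multipliable_inv_one_sub_X_pow_mul hd)]
    simp [hd]
  have h2 : Tendsto (fun m : ℕ ↦ 2 * m) atTop atTop :=
    tendsto_id.const_mul_atTop' (by norm_num)
  have hc (j : ℤ) : Tendsto (fun m : ℕ ↦ P m * P (2 * m) *
      (invPoch R d (m - j) * invPoch R d (m + j)) * X ^ e j) atTop (𝓝 (X ^ e j)) := by
    have h := (hP.mul (hP.comp h2)).mul ((tendsto_invPoch (R := R) hd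
      (tendsto_atTop_add_const_right _ (-j) tendsto_natCast_atTop_atTop)).mul (tendsto_invPoch hd
      (tendsto_atTop_add_const_right _ j tendsto_natCast_atTop_atTop)))
    rw [mul_mul_mul_comm, hPU, one_mul] at h
    simpa [sub_eq_add_neg] using h.mul_const (X ^ e j)
  rw [WithPiTopology.tendsto_iff_coeff_tendsto]
  intro n
  have hcoeff (m : ℕ) : coeff n (P m * (P (2 * m) * finiteTheta R d e m m)) =
      ∑ j ∈ (hfin n).toFinset, coeff n (P m * P (2 * m) *
        (invPoch R d (m - j) * invPoch R d (m + j)) * X ^ e j) := by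
    have hs := finite_support_finiteTheta (R := R) d e m m
    rw [finiteTheta, ← mul_assoc, mul_finsum, map_finsum,
      finsum_eq_sum_of_support_subset (s := (hfin n).toFinset)]
    · simp only [mul_assoc]
    · intro j hj
      by_contra hlt
      simp only [Set.Finite.coe_toFinset, Set.mem_ofPred_eq, not_le] at hlt
      apply hj
      simp only [← mul_assoc]
      rw [coeff_mul_X_pow', if_neg (by lia)]
    · exact hs.subset (Function.support_mul_subset_right _ _)
  have hlim : coeff n (countSeries R e) = ∑ j ∈ (hfin n).toFinset, coeff n (X ^ e j : R⟦X⟧) := by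
    simp only [countSeries, coeff_mk, coeff_X_pow, Finset.sum_boole]
    congr 1
    exact Nat.subtype_card _ fun j ↦ by simpa [eq_comm] using fun h : e j = n ↦ h.le
  rw [hlim]
  refine Tendsto.congr (fun m ↦ (hcoeff m).symm) ?_
  exact tendsto_finsetSum _ fun j _ ↦
    ((WithPiTopology.continuous_coeff R n).tendsto _).comp (hc j)

end JacobiTriple

section PedSeries

variable (R : Type*) [Field R]

/-- The generating series of `ped`. -/
noncomputable def pedSeries : R⟦X⟧ := PowerSeries.mk fun n ↦ (ped n : R)

lemma pedSeries_eq_genFun :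
    pedSeries R = Nat.Partition.genFun fun i c ↦ if Even i → c ≤ 1 then (1 : R) else 0 := by
  classical
  ext n
  rw [pedSeries, coeff_mk, Nat.Partition.coeff_genFun, ped, Nat.card_eq_fintype_card,
    Fintype.card_subtype]
  simp_rw [Finset.card_filter, Finsupp.prod, Finset.prod_boole]
  push_cast
  refine Finset.sum_congr rfl fun p _ ↦ ?_
  refine if_congr ⟨fun h i _ ↦ by simpa using h i, fun h i hi ↦ ?_⟩ rfl rfl
  by_cases hip : i ∈ p.parts
  · simpa using h i (by simpa using hip) hi
  · simp [hip]

lemma prod_one_add_X_pow_two_mul (m : ℕ) :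
    ∏ i ∈ Finset.range (2 * m), (1 + X ^ (i + 1) : R⟦X⟧) =
      (∏ i ∈ Finset.range m, (1 + X ^ (2 * i + 1))) *
        ∏ i ∈ Finset.range m, (1 + X ^ (2 * i + 2)) := by
  induction m with
  | zero => simp
  | succ m ih =>
    rw [mul_add_one, Finset.prod_range_succ, Finset.prod_range_succ, ih, Finset.prod_range_succ,
      Finset.prod_range_succ]
    ring

lemma one_add_X_pow_mul_prod (m : ℕ) :
    (1 + X ^ m) * ∏ i ∈ Finset.range m, ((1 - X ^ (1 * (i + 1))) *
      ((1 + X ^ (1 + 1 * i)) * (1 + X ^ (0 + 1 * i)) : R⟦X⟧)) =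
      2 * ((∏ i ∈ Finset.range m, (1 + X ^ (i + 1))) *
        ∏ i ∈ Finset.range m, (1 - X ^ (2 * (i + 1)))) := by
  induction m with
  | zero => simp [one_add_one_eq_two]
  | succ m ih =>
    rw [Finset.prod_range_succ, Finset.prod_range_succ, Finset.prod_range_succ]
    linear_combination (1 + X ^ (m + 1)) * (1 - X ^ (2 * (m + 1))) * ih

variable [TopologicalSpace R]

lemma multipliable_one_add_X_pow :
    Multipliable fun i : ℕ ↦ (1 + X ^ (i + 1) : R⟦X⟧) := by
  apply WithPiTopology.multipliable_one_add_of_tendsto_order_atTop_nhds_top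
  refine ENat.tendsto_nhds_top_iff_natCast_lt.mpr fun n ↦ eventually_atTop.mpr ⟨n, fun m hm ↦ ?_⟩
  rw [order_X_pow]
  exact_mod_cast Nat.lt_succ_of_le hm

variable [IsTopologicalRing R]

lemma tendsto_rescale {D : ℕ → R⟦X⟧} {F : R⟦X⟧} (a : R) (h : Tendsto D atTop (𝓝 F)) :
    Tendsto (fun m ↦ rescale a (D m)) atTop (𝓝 (rescale a F)) := by
  rw [WithPiTopology.tendsto_iff_coeff_tendsto] at h ⊢
  simpa only [coeff_rescale] using fun n ↦ (h n).const_mul (a ^ n)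

variable [T2Space R]

lemma tendsto_pedSeries : ∃ D : ℕ → R⟦X⟧, Tendsto D atTop (𝓝 (pedSeries R)) ∧
    ∀ m, D m * ∏ i ∈ Finset.range m, (1 - X ^ (2 * i + 1)) =
      ∏ i ∈ Finset.range m, (1 + X ^ (2 * i + 2)) := by
  have h := Nat.Partition.hasProd_genFun (fun i c ↦ if Even i → c ≤ 1 then (1 : R) else 0)
  rw [← pedSeries_eq_genFun] at h
  refine ⟨_, h.tendsto_prod_nat.comp (tendsto_id.const_mul_atTop' (r := 2) (by norm_num)),
    fun m ↦ ?_⟩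
  simp only [Function.comp_apply, id_eq]
  induction m with
  | zero => simp
  | succ m ih =>
    rw [Finset.prod_range_succ, Finset.prod_range_succ _ m, ← ih, mul_add_one,
      Finset.prod_range_succ _ (2 * m + 1), Finset.prod_range_succ _ (2 * m)]
    have hodd : (1 + ∑' j : ℕ, (if Even (2 * m + 1) → j + 1 ≤ 1 then (1 : R) else 0) •
        (X : R⟦X⟧) ^ ((2 * m + 1) * (j + 1))) * (1 - X ^ (2 * m + 1)) = 1 := by
      have hs := WithPiTopology.summable_pow_of_constantCoeff_eq_zero
        (f := (X : R⟦X⟧) ^ (2 * m + 1)) (by simp)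
      have h1 := WithPiTopology.tsum_pow_mul_one_sub_of_constantCoeff_eq_zero
        (f := (X : R⟦X⟧) ^ (2 * m + 1)) (by simp)
      rw [hs.tsum_eq_zero_add] at h1
      simpa [pow_mul] using h1
    have heven : (1 + ∑' j : ℕ, (if Even (2 * m + 1 + 1) → j + 1 ≤ 1 then (1 : R) else 0) •
        (X : R⟦X⟧) ^ ((2 * m + 1 + 1) * (j + 1))) = 1 + X ^ (2 * m + 2) := by
      rw [tsum_eq_single 0 fun j hj ↦ by simp [hj, parity_simps]]
      simp
    rw [heven]
    linear_combination (∏ x ∈ Finset.range (2 * m), (1 + ∑' j : ℕ,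
      (if Even (x + 1) → j + 1 ≤ 1 then (1 : R) else 0) • (X : R⟦X⟧) ^ ((x + 1) * (j + 1)))) *
      (∏ i ∈ Finset.range m, (1 - X ^ (2 * i + 1))) * (1 + X ^ (2 * m + 2)) * hodd

lemma two_mul_rescale_pedSeries_mul_thetaSq :
    2 * (rescale (-1) (pedSeries R) * thetaSq R) = thetaTri R := by
  obtain ⟨D, hD, hDm⟩ := tendsto_pedSeries R
  have hφ : Tendsto _ atTop (𝓝 (thetaSq R)) := tendsto_jacobi_triple_product (R := R) (d := 2)
    (α := 1) (β := 1) (by norm_num) rfl (e := sqExp) rfl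
    (fun j ↦ by push_cast [coe_sqExp]; ring) (finite_setOf_le_of_abs_le abs_le_sqExp)
  have hψ : Tendsto _ atTop (𝓝 (thetaTri R)) := tendsto_jacobi_triple_product (R := R) (d := 1)
    (α := 1) (β := 0) (by norm_num) rfl (e := triExp) rfl
    (fun j ↦ by push_cast; linarith [two_mul_triExp j, two_mul_triExp (j + 1)])
    (finite_setOf_le_of_abs_le abs_le_triExp)
  have hW := (multipliable_one_add_X_pow R).hasProd.tendsto_prod_nat
  have hZ :=
    (multipliable_one_sub_X_pow_mul (R := R) (d := 2) (by norm_num)).hasProd.tendsto_prod_nat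
  have hX : Tendsto (fun m : ℕ ↦ (X : R⟦X⟧) ^ m) atTop (𝓝 0) :=
    WithPiTopology.isTopologicallyNilpotent_of_constantCoeff_zero (by simp)
  have h1 := tendsto_nhds_unique (((hX.const_add 1).mul hψ).congr (one_add_X_pow_mul_prod R))
    ((hW.mul hZ).const_mul 2)
  have hprod (m : ℕ) : rescale (-1) (D m) * ∏ i ∈ Finset.range m, (1 - X ^ (2 * (i + 1))) *
      ((1 + X ^ (1 + 2 * i)) * (1 + X ^ (1 + 2 * i))) =
      (∏ i ∈ Finset.range (2 * m), (1 + X ^ (i + 1))) *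
        ∏ i ∈ Finset.range m, (1 - X ^ (2 * (i + 1)) : R⟦X⟧) := by
    have h := congrArg (rescale (-1 : R)) (hDm m)
    simp only [map_mul, map_prod, map_sub, map_add, map_one, map_pow, rescale_X] at h
    have ho (i : ℕ) : (1 - (C (-1 : R) * X) ^ (2 * i + 1) : R⟦X⟧) = 1 + X ^ (2 * i + 1) := by
      simp [mul_pow, pow_succ, pow_mul]
    have he (i : ℕ) : (1 + (C (-1 : R) * X) ^ (2 * i + 2) : R⟦X⟧) = 1 + X ^ (2 * i + 2) := by
      simp [mul_pow, pow_succ, pow_mul]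
    simp only [ho, he] at h
    simp only [add_comm 1 (2 * _), Finset.prod_mul_distrib, prod_one_add_X_pow_two_mul, ← h]
    ring
  have h2 := tendsto_nhds_unique (((tendsto_rescale R (-1) hD).mul hφ).congr hprod)
    ((hW.comp (tendsto_id.const_mul_atTop' (r := 2) (by norm_num))).mul hZ)
  rw [h2, ← h1, add_zero, one_mul]

end PedSeries

lemma R23_eq_coeff {R : Type*} [CommRing R] (n : ℕ) :
    (R23 (8 * n + 3) : R) = coeff n (thetaSq R * expand 3 (by norm_num) (thetaTri R)) := by
  have h3 := finite_fiber_of_abs_le (abs_le_const_mul abs_le_triExp (c := 3) (by norm_num))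
  rw [thetaSq, thetaTri, ← countSeries_const_mul,
    countSeries_mul (finite_fiber_of_abs_le abs_le_sqExp) h3, countSeries, coeff_mk, R23]
  have hmem (p : {p : ℤ × ℤ // sqExp p.1 + 3 * triExp p.2 = n}) :
      2 * (2 * p.1.1) ^ 2 + 3 * (2 * p.1.2 + 1) ^ 2 = ((8 * n + 3 : ℕ) : ℤ) := by
    have h : ((sqExp p.1.1 + 3 * triExp p.1.2 : ℕ) : ℤ) = n := by exact_mod_cast p.2
    push_cast [coe_sqExp] at h ⊢
    linarith [two_mul_triExp p.1.2]
  refine congrArg _ (Nat.card_congr (Equiv.ofBijective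
    (fun p ↦ ⟨(2 * p.1.1, 2 * p.1.2 + 1), hmem p⟩) ⟨?_, ?_⟩)).symm
  · rintro ⟨⟨a, b⟩, _⟩ ⟨⟨c, d⟩, _⟩ h
    simp only [Subtype.mk.injEq, Prod.mk.injEq] at h ⊢
    lia
  · rintro ⟨⟨x, y⟩, h⟩
    push_cast at h
    obtain ⟨k, rfl | rfl⟩ := Int.even_or_odd' y
    · ring_nf at h
      lia
    obtain ⟨c, rfl | rfl⟩ := Int.even_or_odd' x
    swap
    · have := two_mul_triExp k
      have := two_mul_triExp c
      ring_nf at *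
      lia
    refine ⟨⟨(c, k), ?_⟩, rfl⟩
    zify
    linarith [two_mul_triExp k, coe_sqExp c]

lemma thetaSq_ne_zero : thetaSq (ZMod 3) ≠ 0 := by
  intro h
  have : coeff 0 (thetaSq (ZMod 3)) = 1 := by
    rw [thetaSq, countSeries, coeff_mk]
    have : Nat.card {k // sqExp k = 0} = 1 := by
      rw [Nat.card_eq_one_iff_unique]
      refine ⟨⟨fun a b ↦ Subtype.ext ?_⟩, ⟨0, rfl⟩⟩
      have ha := coe_sqExp a
      have hb := coe_sqExp b
      rw [a.2] at ha
      rw [b.2] at hb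
      rw [pow_eq_zero_iff two_ne_zero |>.1 ha.symm, pow_eq_zero_iff two_ne_zero |>.1 hb.symm]
    rw [this, Nat.cast_one]
  simp [h] at this

lemma thirdPart_rescale_pedSeries :
    thirdPart (ZMod 3) (rescale (-1) (pedSeries (ZMod 3))) =
      thetaSq (ZMod 3) * expand 3 (by norm_num) (thetaTri (ZMod 3)) := by
  set φ := thetaSq (ZMod 3)
  set ψ := thetaTri (ZMod 3)
  set D := rescale (-1) (pedSeries (ZMod 3))
  have h3 : (3 : (ZMod 3)⟦X⟧) = 0 := by
    rw [← map_ofNat (C (R := ZMod 3)) 3]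
    exact map_zero C
  have hD : 2 * (D * φ) = ψ := two_mul_rescale_pedSeries_mul_thetaSq (ZMod 3)
  have hDφ : D * φ ^ 3 = -(ψ * φ ^ 2) := by
    linear_combination (D * φ ^ 3) * h3 - φ ^ 2 * hD
  refine mul_right_cancel₀ thetaSq_ne_zero ?_
  rw [← thirdPart_mul_expand, expand_three_eq_pow, expand_three_eq_pow, hDφ, map_neg,
    thirdPart_thetaTri_mul_thetaSq_sq]
  ring

theorem ped_congr (n : ℕ) :
    (ped (3 * n + 1) : ℤ) ≡ (-1) ^ (n + 1) * R23 (8 * n + 3) [ZMOD 3] := by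
  have h := congrArg (coeff n) thirdPart_rescale_pedSeries
  rw [← R23_eq_coeff, coeff_thirdPart, coeff_rescale, pedSeries, coeff_mk] at h
  refine (ZMod.intCast_eq_intCast_iff _ _ 3).1 ?_
  push_cast
  have hs : (-1 : ZMod 3) ^ (3 * n + 1) = (-1) ^ (n + 1) := by
    rw [show 3 * n + 1 = n + 1 + 2 * n by ring, pow_add, pow_mul]
    simp
  rw [← h, hs, ← mul_assoc, ← mul_pow]
  simp
end

section
/- Let n ≥ 1 have prime factorization n = 2^a · 3^b · ∏_{i=1}^{r} p_i^{v_i} · ∏_{j=1}^{s} q_j^{w_j}, where the p_i are distinct primes congruent to 1, 5, 7 or 11 (mod 24) and the q_j are distinct primes congruent to 13, 17, 19 or 23 (mod 24), and let t be the number of prime factors of n, counted with multiplicity, that are congruent to 5 or 11 (mod 24). Then p̄_o(3n) ≡ f(n)·(1 + (-1)^{a+b+t}) · ∏_{i=1}^{r}(1 + v_i) · ∏_{j=1}^{s} (1 + (-1)^{w_j})/2 (mod 3), where f(n) = -1 if n ≡ 1, 6, 9 or 10 (mod 12) and f(n) = 1 otherwise. -/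
/-- The integer solutions `(x, y)` of `x ^ 2 + 6 * y ^ 2 = n`. -/
noncomputable def normSols (n : ℕ) : Finset (ℤ × ℤ) :=
  {z ∈ Finset.Icc (-n : ℤ) n ×ˢ Finset.Icc (-n : ℤ) n | z.1 ^ 2 + 6 * z.2 ^ 2 = n}

theorem mem_normSols {n : ℕ} {z : ℤ × ℤ} : z ∈ normSols n ↔ z.1 ^ 2 + 6 * z.2 ^ 2 = n := by
  simp only [normSols, Finset.mem_filter, Finset.mem_product, Finset.mem_Icc, and_iff_right_iff_imp]
  intro h
  refine ⟨⟨?_, ?_⟩, ?_, ?_⟩ <;> nlinarith [sq_nonneg z.1, sq_nonneg z.2, Int.le_self_sq z.1,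
    Int.le_self_sq (-z.1), Int.le_self_sq z.2, Int.le_self_sq (-z.2)]

theorem card_normSols_one : (normSols 1).card = 2 := by
  have : normSols 1 = {(1, 0), (-1, 0)} := by
    ext ⟨x, y⟩
    simp only [mem_normSols, Finset.mem_insert, Finset.mem_singleton, Prod.mk.injEq, Nat.cast_one]
    constructor
    · intro h
      have hy : y = 0 := by
        nlinarith [sq_nonneg x, sq_nonneg y, Int.le_self_sq y, Int.le_self_sq (-y)]
      subst hy
      simpa using h
    · rintro (⟨rfl, rfl⟩ | ⟨rfl, rfl⟩) <;> norm_num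
  rw [this]
  rfl

theorem card_normSols_two : (normSols 2).card = 0 := by
  simp only [Finset.card_eq_zero, Finset.eq_empty_iff_forall_notMem, mem_normSols, Nat.cast_ofNat,
    Prod.forall]
  intro x y h
  have hy : y = 0 := by nlinarith [sq_nonneg x, sq_nonneg y, Int.le_self_sq y, Int.le_self_sq (-y)]
  subst hy
  have : x ≤ 1 := by nlinarith
  have : -1 ≤ x := by nlinarith
  interval_cases x <;> omega

theorem card_normSols_four_mul (n : ℕ) : (normSols (4 * n)).card = (normSols n).card := by
  symm
  refine Finset.card_bij (fun z _ => (2 * z.1, 2 * z.2)) ?_ ?_ ?_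
  · intro z hz
    rw [mem_normSols] at hz ⊢
    push_cast
    linarith
  · rintro ⟨x, y⟩ _ ⟨x', y'⟩ _ h
    simp only [Prod.mk.injEq] at h ⊢
    omega
  · rintro ⟨x, y⟩ h
    rw [mem_normSols] at h
    push_cast at h
    obtain ⟨u, hu⟩ : (2 : ℤ) ∣ x :=
      Int.prime_two.dvd_of_dvd_pow (n := 2) ⟨2 * n - 3 * y ^ 2, by linarith⟩
    subst hu
    obtain ⟨v, hv⟩ : (2 : ℤ) ∣ y := by
      refine Int.prime_two.dvd_of_dvd_pow (n := 2) ⟨n - u ^ 2 - y ^ 2, by linarith⟩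
    subst hv
    exact ⟨(u, v), mem_normSols.2 (by simp only; linarith), rfl⟩

theorem card_normSols_three_mul (n : ℕ) : (normSols (3 * n)).card = (normSols (2 * n)).card := by
  symm
  have even (x y : ℤ) (h : x ^ 2 + 6 * y ^ 2 = ((2 * n : ℕ) : ℤ)) : 2 * (x / 2) = x := by
    refine Int.mul_ediv_cancel' (Int.prime_two.dvd_of_dvd_pow (n := 2) ⟨n - 3 * y ^ 2, ?_⟩)
    push_cast at h
    linarith
  refine Finset.card_bij (fun z _ => (3 * z.2, z.1 / 2)) ?_ ?_ ?_
  · rintro ⟨x, y⟩ hz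
    rw [mem_normSols] at hz ⊢
    have := even x y hz
    simp only at hz ⊢
    generalize x / 2 = u at *
    subst this
    push_cast at hz ⊢
    linarith
  · rintro ⟨x, y⟩ h ⟨x', y'⟩ h' e
    have := even x y (mem_normSols.1 h)
    have := even x' y' (mem_normSols.1 h')
    simp only [Prod.mk.injEq] at e ⊢
    omega
  · rintro ⟨x, y⟩ h
    rw [mem_normSols] at h
    push_cast at h
    obtain ⟨u, hu⟩ : (3 : ℤ) ∣ x :=
      Int.prime_three.dvd_of_dvd_pow (n := 2) ⟨n - 2 * y ^ 2, by linarith⟩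
    subst hu
    refine ⟨(2 * y, u), mem_normSols.2 ?_, by simp⟩
    push_cast
    linarith

/-- The solutions for `p ^ 2 * m` both of whose coordinates are divisible by `p`. -/
theorem card_normSols_filter_dvd {p : ℕ} (hp : 0 < p) (m : ℕ) :
    {z ∈ normSols (p ^ 2 * m) | (p : ℤ) ∣ z.1 ∧ (p : ℤ) ∣ z.2}.card = (normSols m).card := by
  symm
  have hp' : (p : ℤ) ≠ 0 := by positivity
  refine Finset.card_bij (fun z _ => (p * z.1, p * z.2)) ?_ ?_ ?_
  · intro z hz
    rw [mem_normSols] at hz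
    simp only [Finset.mem_filter, mem_normSols, dvd_mul_right, and_self, and_true]
    push_cast
    rw [← hz]
    ring
  · rintro ⟨x, y⟩ _ ⟨x', y'⟩ _ h
    simpa [hp.ne'] using h
  · rintro ⟨x, y⟩ h
    simp only [Finset.mem_filter, mem_normSols] at h
    obtain ⟨h, ⟨u, rfl⟩, ⟨v, rfl⟩⟩ := h
    refine ⟨(u, v), mem_normSols.2 ?_, rfl⟩
    have : (p : ℤ) ^ 2 * (u ^ 2 + 6 * v ^ 2) = p ^ 2 * m := by push_cast at h; linarith
    exact mul_left_cancel₀ (pow_ne_zero 2 hp') this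

theorem dvd_of_prime_inert {p : ℕ} [Fact p.Prime] (h : ¬ IsSquare (-6 : ZMod p)) {x y : ℤ}
    (hxy : (p : ℤ) ∣ x ^ 2 + 6 * y ^ 2) : (p : ℤ) ∣ x ∧ (p : ℤ) ∣ y := by
  simp only [← ZMod.intCast_zmod_eq_zero_iff_dvd] at hxy ⊢
  push_cast at hxy
  have hy : (y : ZMod p) = 0 := by
    by_contra hy
    refine h ⟨x / y, ?_⟩
    field_simp
    linear_combination -hxy
  simp only [hy] at hxy
  exact ⟨by simpa using hxy, hy⟩

theorem card_normSols_inert_pow_mul {p : ℕ} [hp : Fact p.Prime] (h : ¬ IsSquare (-6 : ZMod p))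
    {m : ℕ} (hm : ¬ p ∣ m) (w : ℕ) :
    ((normSols (p ^ w * m)).card : ℤ) = (1 + (-1) ^ w) / 2 * (normSols m).card := by
  induction w using Nat.twoStepInduction with
  | zero => simp
  | one =>
    simp only [pow_one, add_neg_cancel, EuclideanDomain.zero_div, zero_mul, Nat.cast_eq_zero,
      Finset.card_eq_zero, Finset.eq_empty_iff_forall_notMem, mem_normSols]
    intro z hz
    obtain ⟨⟨u, hu⟩, ⟨v, hv⟩⟩ := dvd_of_prime_inert h ⟨m, by rw [hz]; push_cast; rfl⟩
    rw [hu, hv] at hz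
    have : (p : ℤ) * (p * (u ^ 2 + 6 * v ^ 2)) = p * m := by push_cast at hz; linarith
    have := mul_left_cancel₀ (by exact_mod_cast hp.1.ne_zero) this
    exact hm (Int.natCast_dvd_natCast.1 ⟨_, this.symm⟩)
  | more w ih _ =>
    rw [pow_add _ w 2, pow_add _ w 2, neg_one_sq, mul_one, ← ih, mul_right_comm, mul_comm,
      ← card_normSols_filter_dvd hp.1.pos (p ^ w * m), Finset.filter_true_of_mem]
    intro z hz
    rw [mem_normSols] at hz
    exact dvd_of_prime_inert h ⟨p * (p ^ w * m : ℕ), by rw [hz]; push_cast; ring⟩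

/-- The solutions for `p * m` that are multiples of `a + b * √-6`, an element of norm `c * p`. -/
theorem card_normSols_filter_mul_dvd {p : ℕ} (hp : 0 < p) {c : ℕ} (hc : c = 1 ∨ c = 2) {a b : ℤ}
    (hab : a ^ 2 + 6 * b ^ 2 = c * p) (m : ℕ) :
    {z ∈ normSols (p * m) | (p : ℤ) ∣ a * z.1 + 6 * b * z.2 ∧ (p : ℤ) ∣ a * z.2 - b * z.1}.card =
      (normSols (c * m)).card := by
  have hp' : (p : ℤ) ≠ 0 := by positivity
  have hc' : (c : ℤ) ≠ 0 := by rcases hc with rfl | rfl <;> norm_num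
  refine Finset.card_bij
    (fun z _ => ((a * z.1 + 6 * b * z.2) / p, (a * z.2 - b * z.1) / p)) ?_ ?_ ?_
  · rintro ⟨x, y⟩ h
    simp only [Finset.mem_filter, mem_normSols] at h ⊢
    obtain ⟨h, ⟨u, hu⟩, ⟨v, hv⟩⟩ := h
    rw [hu, hv, Int.mul_ediv_cancel_left _ hp', Int.mul_ediv_cancel_left _ hp']
    refine mul_left_cancel₀ (pow_ne_zero 2 hp') ?_
    push_cast at h ⊢
    linear_combination (-(p * u) - (a * x + 6 * b * y)) * hu
      + 6 * (-(p * v) - (a * y - b * x)) * hv + (a ^ 2 + 6 * b ^ 2) * h + (p * m : ℤ) * hab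
  · rintro ⟨x, y⟩ h ⟨x', y'⟩ h' e
    simp only [Finset.mem_filter, mem_normSols, Prod.mk.injEq] at h h' e ⊢
    obtain ⟨h, ⟨u, hu⟩, ⟨v, hv⟩⟩ := h
    obtain ⟨h', ⟨u', hu'⟩, ⟨v', hv'⟩⟩ := h'
    rw [hu, hv, hu', hv'] at e
    simp only [Int.mul_ediv_cancel_left _ hp'] at e
    obtain ⟨rfl, rfl⟩ := e
    have hcp : (c * p : ℤ) ≠ 0 := mul_ne_zero hc' hp'
    constructor <;> apply mul_left_cancel₀ hcp
    · linear_combination (x' - x) * hab + a * hu - a * hu' - 6 * b * hv + 6 * b * hv'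
    · linear_combination (y' - y) * hab + b * hu - b * hu' + a * hv - a * hv'
  · rintro ⟨x, y⟩ h
    rw [mem_normSols] at h
    push_cast at h
    obtain ⟨⟨u, hu⟩, ⟨v, hv⟩⟩ : (c : ℤ) ∣ a * x - 6 * b * y ∧ (c : ℤ) ∣ a * y + b * x := by
      rcases hc with rfl | rfl
      · simp
      · obtain ⟨x', rfl⟩ : (2 : ℤ) ∣ x :=
          Int.prime_two.dvd_of_dvd_pow (n := 2) ⟨m - 3 * y ^ 2, by push_cast at h; linarith⟩
        obtain ⟨a', rfl⟩ : (2 : ℤ) ∣ a :=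
          Int.prime_two.dvd_of_dvd_pow (n := 2) ⟨p - 3 * b ^ 2, by push_cast at hab; linarith⟩
        exact ⟨⟨2 * a' * x' - 3 * b * y, by push_cast; ring⟩, ⟨a' * y + b * x', by push_cast; ring⟩⟩
    have h₁ : a * u + 6 * b * v = p * x := by
      apply mul_left_cancel₀ hc'
      linear_combination -a * hu - 6 * b * hv + x * hab
    have h₂ : a * v - b * u = p * y := by
      apply mul_left_cancel₀ hc'
      linear_combination b * hu - a * hv + y * hab
    refine ⟨(u, v), Finset.mem_filter.2 ⟨mem_normSols.2 ?_, ?_, ?_⟩, ?_⟩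
    · apply mul_left_cancel₀ (pow_ne_zero 2 hc')
      push_cast
      linear_combination (-(c * u) - (a * x - 6 * b * y)) * hu
        + 6 * (-(c * v) - (a * y + b * x)) * hv + (a ^ 2 + 6 * b ^ 2) * h + (c * m : ℤ) * hab
    · exact ⟨x, h₁⟩
    · exact ⟨y, h₂⟩
    · simp only [h₁, h₂, Int.mul_ediv_cancel_left _ hp']

theorem card_normSols_prime_mul_add {p : ℕ} (hp : p.Prime) (hp3 : 3 < p) {c : ℕ} (hc : c = 1 ∨ c = 2)
    {a b : ℤ} (hab : a ^ 2 + 6 * b ^ 2 = c * p) (m : ℕ) :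
    (normSols (p * m)).card +
      {z ∈ normSols (p * m) | (p : ℤ) ∣ z.1 ∧ (p : ℤ) ∣ z.2}.card =
        2 * (normSols (c * m)).card := by
  have hpp : Prime (p : ℤ) := Nat.prime_iff_prime_int.1 hp
  have h2 : ¬ (p : ℤ) ∣ 2 := fun h => by have := Int.le_of_dvd (by norm_num) h; omega
  have h3 : ¬ (p : ℤ) ∣ 3 := fun h => by have := Int.le_of_dvd (by norm_num) h; omega
  have h6 : ¬ (p : ℤ) ∣ 6 := fun h => by
    rw [show (6 : ℤ) = 2 * 3 by norm_num, hpp.dvd_mul] at h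
    tauto
  have hsq : ¬ (p : ℤ) ^ 2 ∣ c * p := by
    rw [sq, mul_dvd_mul_iff_right hpp.ne_zero]
    rcases hc with rfl | rfl
    · exact fun h => hpp.not_dvd_one (by simpa using h)
    · exact_mod_cast h2
  have hab' : (p : ℤ) ∣ a ^ 2 + 6 * b ^ 2 := ⟨c, by rw [hab, mul_comm]⟩
  have hb : ¬ (p : ℤ) ∣ b := by
    intro h
    have ha : (p : ℤ) ∣ a := hpp.dvd_of_dvd_pow ((dvd_add_left (by
      exact (dvd_pow h two_ne_zero).mul_left 6)).1 hab')
    exact hsq (hab ▸ dvd_add (pow_dvd_pow_of_dvd ha 2) ((pow_dvd_pow_of_dvd h 2).mul_left 6))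
  have ha : ¬ (p : ℤ) ∣ a := by
    intro h
    have := (dvd_add_right (dvd_pow h two_ne_zero)).1 hab'
    exact hb (hpp.dvd_of_dvd_pow ((hpp.dvd_mul.1 this).resolve_left h6))
  have key₁ (b : ℤ) (hb : ¬ (p : ℤ) ∣ b) (hab' : (p : ℤ) ∣ a ^ 2 + 6 * b ^ 2) (z : ℤ × ℤ)
      (h : (p : ℤ) ∣ a * z.2 - b * z.1) : (p : ℤ) ∣ a * z.1 + 6 * b * z.2 := by
    refine (hpp.dvd_mul.1 (?_ : (p : ℤ) ∣ b * (a * z.1 + 6 * b * z.2))).resolve_left hb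
    rw [show b * (a * z.1 + 6 * b * z.2) = (a ^ 2 + 6 * b ^ 2) * z.2 - a * (a * z.2 - b * z.1) by
      ring]
    exact dvd_sub (hab'.mul_right _) (h.mul_left _)
  have hneg : (p : ℤ) ∣ a ^ 2 + 6 * (-b) ^ 2 := by rwa [neg_sq]
  have hb' : ¬ (p : ℤ) ∣ -b := by rwa [dvd_neg]
  have h₁ := card_normSols_filter_mul_dvd hp.pos hc hab m
  have h₂ := card_normSols_filter_mul_dvd hp.pos hc (a := a) (b := -b) (by rwa [neg_sq]) m
  rw [two_mul]
  nth_rw 1 [← h₁]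
  rw [← h₂]
  refine Eq.trans ?_ (Finset.card_union_add_card_inter _ _)
  rw [← Finset.filter_or, ← Finset.filter_and]
  congr 2
  · symm
    rw [Finset.filter_eq_self]
    intro z hz
    rw [mem_normSols] at hz
    have : (p : ℤ) ∣ (a * z.2 - b * z.1) * (a * z.2 - -b * z.1) := by
      rw [show (a * z.2 - b * z.1) * (a * z.2 - -b * z.1) =
        (a ^ 2 + 6 * b ^ 2) * z.2 ^ 2 - b ^ 2 * (z.1 ^ 2 + 6 * z.2 ^ 2) by ring, hz]
      push_cast
      exact dvd_sub (hab'.mul_right _) ((dvd_mul_right _ _).mul_left _)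
    exact (hpp.dvd_mul.1 this).imp (fun h => ⟨key₁ b hb hab' z h, h⟩)
      (fun h => ⟨key₁ (-b) hb' hneg z h, h⟩)
  · refine Finset.filter_congr fun z _ => ⟨fun h => ?_, ?_⟩
    · exact ⟨⟨dvd_add (h.1.mul_left _) (h.2.mul_left _), dvd_sub (h.2.mul_left _) (h.1.mul_left _)⟩,
        ⟨dvd_add (h.1.mul_left _) (h.2.mul_left _), dvd_sub (h.2.mul_left _) (h.1.mul_left _)⟩⟩
    · rintro ⟨⟨h₁, h₂⟩, ⟨h₃, h₄⟩⟩
      have e₁ := dvd_add h₁ h₃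
      have e₂ := dvd_add h₂ h₄
      ring_nf at e₁ e₂
      exact ⟨(hpp.dvd_mul.1 ((hpp.dvd_mul.1 e₁).resolve_right h2)).resolve_left ha,
        (hpp.dvd_mul.1 ((hpp.dvd_mul.1 e₂).resolve_right h2)).resolve_left ha⟩

theorem card_normSols_split_pow_mul {p : ℕ} (hp : p.Prime) (hp3 : 3 < p) {c : ℕ} (hc : c = 1 ∨ c = 2)
    {a b : ℤ} (hab : a ^ 2 + 6 * b ^ 2 = c * p) {m : ℕ} (hm : ¬ p ∣ m) (v : ℕ) :
    (normSols (p ^ v * m)).card = (1 + v) * (normSols (c ^ v * m)).card := by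
  have hcp : ¬ p ∣ c := fun h => by
    have := Nat.le_of_dvd (by omega) h
    omega
  have hcc (k : ℕ) : (normSols (c * (c * k))).card = (normSols k).card := by
    rcases hc with rfl | rfl
    · simp
    · rw [← mul_assoc, show 2 * 2 = 4 from rfl, card_normSols_four_mul]
  induction v using Nat.twoStepInduction generalizing m with
  | zero => simp
  | one =>
    have h := card_normSols_prime_mul_add hp hp3 hc hab m
    rw [Finset.filter_false_of_mem, Finset.card_empty] at h
    · simpa using h
    · rintro z hz ⟨⟨u, hu⟩, ⟨v, hv⟩⟩
      rw [mem_normSols, hu, hv] at hz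
      have : (p : ℤ) * (p * (u ^ 2 + 6 * v ^ 2)) = p * m := by push_cast at hz; linarith
      have := mul_left_cancel₀ (by exact_mod_cast hp.ne_zero) this
      exact hm (Int.natCast_dvd_natCast.1 ⟨_, this.symm⟩)
  | more v ih ih' =>
    have h := card_normSols_prime_mul_add hp hp3 hc hab (p ^ (v + 1) * m)
    have e : p * (p ^ (v + 1) * m) = p ^ 2 * (p ^ v * m) := by ring
    rw [mul_left_comm c, ih' (hp.dvd_mul.not.2 (by tauto)), e, card_normSols_filter_dvd hp.pos,
      ih hm, ← mul_assoc _ c, ← pow_succ] at h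
    have e' : (normSols (c ^ (v + 2) * m)).card = (normSols (c ^ v * m)).card := by
      rw [← hcc (c ^ v * m)]
      congr 2
      ring
    rw [show p ^ (v + 2) * m = p ^ 2 * (p ^ v * m) by ring]
    rw [e'] at h ⊢
    linarith

theorem isSquare_neg_six_iff {p : ℕ} [hp : Fact p.Prime] (hp3 : 3 < p) :
    IsSquare (-6 : ZMod p) ↔ p % 24 = 1 ∨ p % 24 = 5 ∨ p % 24 = 7 ∨ p % 24 = 11 := by
  have h6 : ((-6 : ℤ) : ZMod p) ≠ 0 := by
    rw [Ne, ZMod.intCast_zmod_eq_zero_iff_dvd, dvd_neg]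
    intro h
    have h' : p ∣ 2 * 3 := by exact_mod_cast h
    rcases hp.1.dvd_mul.1 h' with h | h <;> have := Nat.le_of_dvd (by norm_num) h <;> omega
  have h2 : p % 2 = 1 := hp.1.eq_two_or_odd.resolve_left (by omega)
  have h3 : p % 3 ≠ 0 := fun h => by
    have := (Nat.prime_dvd_prime_iff_eq Nat.prime_three hp.1).1 (Nat.dvd_of_mod_eq_zero h)
    omega
  have h := legendreSym.eq_one_iff p h6
  rw [show ((-6 : ℤ) : ZMod p) = -6 by push_cast; rfl] at h
  rw [← h, jacobiSym.legendreSym.to_jacobiSym, jacobiSym.mod_right _ (Nat.odd_iff.2 h2),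
    show 4 * (-6 : ℤ).natAbs = 24 from rfl]
  have : p % 24 < 24 := Nat.mod_lt _ (by norm_num)
  have h2' : p % 24 % 2 = 1 := by omega
  have h3' : p % 24 % 3 ≠ 0 := by omega
  clear h
  generalize p % 24 = k at *
  interval_cases k <;> first | omega | norm_num

theorem exists_sq_add_six_mul_sq_eq {p : ℕ} [hp : Fact p.Prime] (h : IsSquare (-6 : ZMod p)) :
    ∃ a b : ℤ, a ^ 2 + 6 * b ^ 2 = p ∨ a ^ 2 + 6 * b ^ 2 = 2 * p := by
  obtain ⟨s, hs⟩ := h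
  obtain ⟨r, rfl⟩ := ZMod.intCast_surjective s
  have hpos := hp.1.pos
  have hpR : (0 : ℝ) < p := by exact_mod_cast hpos
  have hn : 0 < Nat.sqrt p := Nat.sqrt_pos.2 hpos
  obtain ⟨j, k, hk0, hkn, hjk⟩ := Real.exists_int_int_abs_mul_sub_le ((r : ℝ) / p) hn
  have hn1 : (Nat.sqrt p : ℤ) * Nat.sqrt p ≤ p := by exact_mod_cast Nat.sqrt_le p
  have hn2 : (p : ℤ) < (Nat.sqrt p + 1) * (Nat.sqrt p + 1) := by
    exact_mod_cast Nat.lt_succ_sqrt p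
  have hn3 : (Nat.sqrt p : ℤ) * Nat.sqrt p ≠ p := fun h =>
    (Nat.prime_iff_prime_int.1 hp.1).irreducible.not_isSquare ⟨_, h.symm⟩
  generalize Nat.sqrt p = n at *
  obtain ⟨x, hx⟩ : ∃ x : ℤ, x = k * r - j * p := ⟨_, rfl⟩
  have hx1 : |x| * (n + 1) ≤ p := by
    have : |(x : ℝ)| * (n + 1) ≤ p := by
      have e : (x : ℝ) = (k * (r / p) - j) * p := by rw [hx]; push_cast; field_simp
      rw [e, abs_mul, abs_of_pos hpR]
      rw [le_div_iff₀ (by positivity)] at hjk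
      nlinarith
    exact_mod_cast this
  have hx2 : |x| ≤ n :=
    Int.lt_add_one_iff.1 (lt_of_mul_lt_mul_right (hx1.trans_lt hn2) (by positivity))
  have hx3 : x ^ 2 ≤ n * n := by
    rw [← sq_abs, sq]
    exact mul_self_le_mul_self (abs_nonneg x) hx2
  have hk : k ^ 2 ≤ n * n := by nlinarith
  obtain ⟨l, hl⟩ : (p : ℤ) ∣ x ^ 2 + 6 * k ^ 2 := by
    rw [← ZMod.intCast_zmod_eq_zero_iff_dvd, hx]
    push_cast
    simp only [CharP.cast_eq_zero, mul_zero, sub_zero]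
    linear_combination -(k : ZMod p) ^ 2 * hs
  have hpZ : (0 : ℤ) < p := by exact_mod_cast hpos
  have hl0 : 0 < l := by nlinarith [sq_nonneg x]
  have hl7 : l < 7 := by
    refine lt_of_mul_lt_mul_left (?_ : (p : ℤ) * l < p * 7) hpZ.le
    have := lt_of_le_of_ne hn1 hn3
    linarith
  clear hx hx1 hx2 hx3 hjk hkn hn1 hn2 hn3 hk hk0 hs hn
  have even (c : ℤ) (h : x ^ 2 + 6 * k ^ 2 = 2 * c) : (2 : ℤ) ∣ x :=
    Int.prime_two.dvd_of_dvd_pow (n := 2) ⟨c - 3 * k ^ 2, by linarith⟩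
  have three (c : ℤ) (h : x ^ 2 + 6 * k ^ 2 = 3 * c) : (3 : ℤ) ∣ x :=
    Int.prime_three.dvd_of_dvd_pow (n := 2) ⟨c - 2 * k ^ 2, by linarith⟩
  interval_cases l
  · exact ⟨x, k, Or.inl (by linarith)⟩
  · exact ⟨x, k, Or.inr (by linarith)⟩
  · obtain ⟨u, rfl⟩ := three p (by linarith)
    exact ⟨2 * k, u, Or.inr (by linarith)⟩
  · obtain ⟨u, rfl⟩ := even (2 * p) (by linarith)
    obtain ⟨v, rfl⟩ : (2 : ℤ) ∣ k := by
      refine Int.prime_two.dvd_of_dvd_pow (n := 2) ⟨p - u ^ 2 - k ^ 2, by linarith⟩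
    exact ⟨u, v, Or.inl (by linarith)⟩
  · have h5 : Prime (5 : ℤ) := by norm_num
    have : (5 : ℤ) ∣ (x + 2 * k) * (x - 2 * k) := ⟨p - 2 * k ^ 2, by linarith⟩
    rcases h5.dvd_mul.1 this with ⟨u, hu⟩ | ⟨u, hu⟩
    · obtain rfl : x = 5 * u - 2 * k := by linarith
      exact ⟨2 * (u - k), u, Or.inr (by linarith)⟩
    · obtain rfl : x = 5 * u + 2 * k := by linarith
      exact ⟨2 * (u + k), u, Or.inr (by linarith)⟩
  · obtain ⟨u, rfl⟩ := three (2 * p) (by linarith)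
    obtain ⟨v, hv⟩ := even (3 * p) (by linarith)
    obtain ⟨w, rfl⟩ : (2 : ℤ) ∣ u := by omega
    exact ⟨k, w, Or.inl (by linarith)⟩

/-- For a prime `p > 3` modulo which `-6` is a square, `p` is a norm from `ℤ[√-6]` if `p ≡ 1, 7`
modulo `24`, and otherwise `2 * p` is. -/
theorem exists_sq_add_six_mul_sq_eq_mul {p : ℕ} (hp : p.Prime)
    (h : p % 24 = 1 ∨ p % 24 = 5 ∨ p % 24 = 7 ∨ p % 24 = 11) :
    ∃ a b : ℤ, a ^ 2 + 6 * b ^ 2 = (if p % 24 = 5 ∨ p % 24 = 11 then 2 else 1 : ℕ) * p := by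
  have := Fact.mk hp
  have hp3 : 3 < p := by
    have := hp.one_lt
    by_contra! h
    interval_cases p <;> omega
  obtain ⟨a, b, hab⟩ := exists_sq_add_six_mul_sq_eq ((isSquare_neg_six_iff hp3).2 h)
  refine ⟨a, b, ?_⟩
  have ha : a ^ 2 % 3 = 0 ∨ a ^ 2 % 3 = 1 := by
    have : a % 3 = 0 ∨ a % 3 = 1 ∨ a % 3 = 2 := by omega
    rcases this with h | h | h <;> simp [pow_two, Int.mul_emod, h]
  split_ifs <;> push_cast <;> omega

/-- The number of representations by `x ^ 2 + 6 * y ^ 2` in terms of the prime factorization. -/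
theorem card_normSols_eq {ι κ : Type*} [Fintype ι] [Fintype κ] (a b : ℕ) (p : ι → ℕ) (v : ι → ℕ)
    (q : κ → ℕ) (w : κ → ℕ) (hp : ∀ i, (p i).Prime) (hq : ∀ j, (q j).Prime)
    (hpinj : Function.Injective p) (hqinj : Function.Injective q)
    (hpmod : ∀ i, p i % 24 = 1 ∨ p i % 24 = 5 ∨ p i % 24 = 7 ∨ p i % 24 = 11)
    (hqmod : ∀ j, q j % 24 = 13 ∨ q j % 24 = 17 ∨ q j % 24 = 19 ∨ q j % 24 = 23) :
    ((normSols (2 ^ a * 3 ^ b * (∏ i, p i ^ v i) * (∏ j, q j ^ w j))).card : ℤ) =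
      (1 + (-1) ^ (a + b + ∑ i, if p i % 24 = 5 ∨ p i % 24 = 11 then v i else 0)) *
        (∏ i, (1 + (v i : ℤ))) * (∏ j, (1 + (-1 : ℤ) ^ (w j)) / 2) := by
  classical
  have two (a : ℕ) : ((normSols (2 ^ a)).card : ℤ) = 1 + (-1) ^ a := by
    induction a using Nat.twoStepInduction with
    | zero => simp [card_normSols_one]
    | one => simp [card_normSols_two]
    | more a ih _ =>
      rw [show 2 ^ (a + 2) = 4 * 2 ^ a by ring, card_normSols_four_mul, ih]
      ring
  have three (b m : ℕ) : (normSols (3 ^ b * m)).card = (normSols (2 ^ b * m)).card := by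
    induction b generalizing m with
    | zero => rfl
    | succ b ih =>
      rw [show 3 ^ (b + 1) * m = 3 * (3 ^ b * m) by ring, card_normSols_three_mul,
        show 2 * (3 ^ b * m) = 3 ^ b * (2 * m) by ring, ih]
      ring_nf
  have gt3 (i : ι) : 3 < p i := by
    have := (hp i).one_lt
    by_contra! h
    have := hpmod i
    interval_cases p i <;> omega
  have gt3' (j : κ) : 3 < q j := by
    have := (hq j).one_lt
    by_contra! h
    have := hqmod j
    interval_cases q j <;> omega
  have inert (s : Finset κ) (m : ℕ) (hm : ∀ j ∈ s, ¬ q j ∣ m) :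
      ((normSols ((∏ j ∈ s, q j ^ w j) * m)).card : ℤ) =
        (∏ j ∈ s, (1 + (-1 : ℤ) ^ (w j)) / 2) * (normSols m).card := by
    induction s using Finset.induction_on with
    | empty => simp
    | insert j s hj ih =>
      have := Fact.mk (hq j)
      rw [Finset.prod_insert hj, Finset.prod_insert hj, mul_assoc, mul_assoc,
        ← ih fun i hi => hm i (Finset.mem_insert_of_mem hi)]
      refine card_normSols_inert_pow_mul ?_ ?_ _
      · rw [isSquare_neg_six_iff (gt3' j)]
        have := hqmod j
        omega
      · rw [(hq j).dvd_mul, not_or, (hq j).prime.dvd_finsetProd_iff]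
        refine ⟨?_, hm j (Finset.mem_insert_self _ _)⟩
        rintro ⟨i, hi, h⟩
        have := (Nat.prime_dvd_prime_iff_eq (hq j) (hq i)).1 ((hq j).dvd_of_dvd_pow h)
        exact hj (hqinj this ▸ hi)
  have split (s : Finset ι) (m : ℕ) (hm : ∀ i ∈ s, ¬ p i ∣ m) :
      (normSols ((∏ i ∈ s, p i ^ v i) * m)).card = (∏ i ∈ s, (1 + v i)) *
        (normSols (2 ^ (∑ i ∈ s, if p i % 24 = 5 ∨ p i % 24 = 11 then v i else 0) * m)).card := by
    induction s using Finset.induction_on generalizing m with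
    | empty => simp
    | insert i s hi ih =>
      obtain ⟨a, b, hab⟩ := exists_sq_add_six_mul_sq_eq_mul (hp i) (hpmod i)
      rw [Finset.prod_insert hi, Finset.prod_insert hi, Finset.sum_insert hi, mul_assoc,
        card_normSols_split_pow_mul (hp i) (gt3 i) (by split_ifs <;> simp) hab, mul_left_comm,
        ih, mul_assoc]
      · congr 3
        split_ifs <;> simp [pow_add]
        ring_nf
      · intro j hj
        rw [(hp j).dvd_mul, not_or]
        refine ⟨fun h => ?_, hm j (Finset.mem_insert_of_mem hj)⟩
        have := Nat.le_of_dvd (by split_ifs <;> norm_num) ((hp j).dvd_of_dvd_pow h)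
        have := gt3 j
        split_ifs at * <;> omega
      · rw [(hp i).dvd_mul, not_or, (hp i).prime.dvd_finsetProd_iff]
        refine ⟨?_, hm i (Finset.mem_insert_self _ _)⟩
        rintro ⟨j, hj, h⟩
        have := (Nat.prime_dvd_prime_iff_eq (hp i) (hp j)).1 ((hp i).dvd_of_dvd_pow h)
        exact hi (hpinj this ▸ hj)
  have hsmall (l : ℕ) (hl : l.Prime) (hl3 : 3 < l) : ¬ l ∣ 2 ^ a * 3 ^ b := by
    intro h
    rcases hl.dvd_mul.1 h with h | h <;>
      have := Nat.le_of_dvd (by norm_num) (hl.dvd_of_dvd_pow h) <;> omega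
  rw [mul_comm, inert, mul_comm]
  · congr 1
    rw [mul_comm (2 ^ a * 3 ^ b), split, mul_comm]
    · push_cast
      congr 1
      rw [show ∀ t, 2 ^ t * (2 ^ a * 3 ^ b) = 3 ^ b * (2 ^ t * 2 ^ a) by intro t; ring, three,
        ← pow_add, ← pow_add, two]
      ring_nf
    · exact fun i _ => hsmall _ (hp i) (gt3 i)
  · intro j _
    rw [(hq j).dvd_mul, not_or, (hq j).prime.dvd_finsetProd_iff]
    refine ⟨hsmall _ (hq j) (gt3' j), ?_⟩
    rintro ⟨i, _, h⟩
    have := (Nat.prime_dvd_prime_iff_eq (hq j) (hp i)).1 ((hq j).dvd_of_dvd_pow h)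
    have h1 := hpmod i
    have h2 := hqmod j
    omega

open PowerSeries in
/-- The power series `∑ i, w i * X ^ Q i`, for a map `Q` with finite fibres. -/
noncomputable def weightSeries {R ι : Type*} [Semiring R] (Q : ι → ℕ) (w : ι → R) : R⟦X⟧ :=
  PowerSeries.mk fun n => ∑ᶠ i ∈ {i | Q i = n}, w i

section WeightSeries

open PowerSeries

variable {R ι κ : Type*}

theorem coeff_weightSeries [Semiring R] {Q : ι → ℕ} {w : ι → R} {n : ℕ} (s : Finset ι)
    (hs : ∀ i, i ∈ s ↔ Q i = n) : coeff n (weightSeries Q w) = ∑ i ∈ s, w i := by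
  rw [weightSeries, coeff_mk, ← finsum_mem_coe_finset]
  congr! 3 with i
  simp [hs]

theorem weightSeries_mul [CommSemiring R] {Q : ι → ℕ} {Q' : κ → ℕ} (hQ : ∀ n, {i | Q i = n}.Finite)
    (hQ' : ∀ n, {i | Q' i = n}.Finite) (w : ι → R) (w' : κ → R) :
    weightSeries Q w * weightSeries Q' w' =
      weightSeries (fun z : ι × κ => Q z.1 + Q' z.2) fun z => w z.1 * w' z.2 := by
  classical
  ext n
  rw [coeff_mul, coeff_weightSeries
    ((Finset.HasAntidiagonal.antidiagonal n).biUnion fun k =>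
      (hQ k.1).toFinset ×ˢ (hQ' k.2).toFinset) (by simp),
    Finset.sum_biUnion]
  · refine Finset.sum_congr rfl fun k _ => ?_
    rw [coeff_weightSeries (hQ k.1).toFinset (by simp), coeff_weightSeries (hQ' k.2).toFinset
      (by simp), Finset.sum_mul_sum, Finset.sum_product]
  · rintro ⟨a, b⟩ _ ⟨c, d⟩ _ h
    rw [Function.onFun, Finset.disjoint_left]
    simp only [Finset.mem_product, Set.Finite.mem_toFinset, Set.mem_ofPred_eq]
    rintro z ⟨rfl, rfl⟩ ⟨rfl, rfl⟩
    exact h rfl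

theorem finite_weight_add {Q : ι → ℕ} {Q' : κ → ℕ} (hQ : ∀ n, {i | Q i = n}.Finite)
    (hQ' : ∀ n, {i | Q' i = n}.Finite) (n : ℕ) :
    {z : ι × κ | Q z.1 + Q' z.2 = n}.Finite := by
  refine ((Finset.range (n + 1)).finite_toSet.biUnion fun k _ =>
    (Finset.range (n + 1)).finite_toSet.biUnion fun l _ => (hQ k).prod (hQ' l)).subset ?_
  intro z hz
  simp only [Set.mem_ofPred_eq] at hz
  simp only [Set.mem_iUnion, Finset.mem_coe, Finset.mem_range]
  exact ⟨Q z.1, by omega, Q' z.2, by omega, rfl, rfl⟩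

theorem expand_weightSeries [CommRing R] {Q : ι → ℕ} {w : ι → R} {k : ℕ} (hk : k ≠ 0) :
    expand k hk (weightSeries Q w) = weightSeries (fun i => k * Q i) w := by
  ext n
  rw [coeff_expand]
  split_ifs with h
  · obtain ⟨m, rfl⟩ := h
    rw [Nat.mul_div_cancel_left _ (Nat.pos_of_ne_zero hk), weightSeries, weightSeries, coeff_mk,
      coeff_mk]
    simp [hk]
  · rw [coeff_weightSeries ∅]
    · simp
    · intro i
      simp only [Finset.notMem_empty, false_iff]
      rintro rfl
      exact h (dvd_mul_right _ _)

end WeightSeries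

section QBinomial

variable {R : Type*} [CommRing R] (q : R)

/-- The Pochhammer symbol `(q; q)_n`. -/
def qPochhammer (n : ℕ) : R := ∏ i ∈ Finset.range n, (1 - q ^ (i + 1))

/-- The Gaussian binomial coefficients. -/
def gaussBinom : ℕ → ℕ → R
  | _, 0 => 1
  | 0, _ + 1 => 0
  | n + 1, k + 1 => gaussBinom n k + q ^ (k + 1) * gaussBinom n (k + 1)

theorem gaussBinom_zero_right (n : ℕ) : gaussBinom q n 0 = 1 := by cases n <;> rfl

theorem gaussBinom_succ_succ (n k : ℕ) : gaussBinom q (n + 1) (k + 1) =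
    gaussBinom q n k + q ^ (k + 1) * gaussBinom q n (k + 1) := rfl

theorem gaussBinom_of_lt {n k : ℕ} (h : n < k) : gaussBinom q n k = 0 := by
  induction n generalizing k with
  | zero =>
    cases k with
    | zero => omega
    | succ k => rfl
  | succ n ih =>
    cases k with
    | zero => omega
    | succ k => rw [gaussBinom_succ_succ, ih (by omega), ih (by omega), mul_zero, add_zero]

theorem gaussBinom_self (n : ℕ) : gaussBinom q n n = 1 := by
  induction n with
  | zero => rfl
  | succ n ih =>
    rw [gaussBinom_succ_succ, ih, gaussBinom_of_lt q n.lt_succ_self, mul_zero, add_zero]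

theorem qPochhammer_succ (n : ℕ) :
    qPochhammer q (n + 1) = qPochhammer q n * (1 - q ^ (n + 1)) :=
  Finset.prod_range_succ _ _

theorem gaussBinom_mul_qPochhammer (k l : ℕ) :
    gaussBinom q (k + l) k * (qPochhammer q k * qPochhammer q l) = qPochhammer q (k + l) := by
  induction k generalizing l with
  | zero => simp [gaussBinom_zero_right, qPochhammer]
  | succ k ih =>
    induction l with
    | zero => simp [gaussBinom_self, qPochhammer]
    | succ l ih' =>
      have h := ih (l + 1)
      rw [show k + (l + 1) = k + 1 + l by ring] at h
      rw [← add_assoc, gaussBinom_succ_succ, add_mul]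
      rw [qPochhammer_succ q (k + 1 + l)]
      rw [qPochhammer_succ q l] at h ⊢
      rw [qPochhammer_succ q k] at ih' ⊢
      linear_combination (1 - q ^ (k + 1)) * h + q ^ (k + 1) * (1 - q ^ (l + 1)) * ih'

theorem prod_add_mul_pow (w z : R) (n : ℕ) :
    ∏ i ∈ Finset.range n, (w + z * q ^ i) =
      ∑ k ∈ Finset.range (n + 1), q ^ (k.choose 2) * gaussBinom q n k * z ^ k * w ^ (n - k) := by
  induction n generalizing z with
  | zero => simp [gaussBinom_zero_right]
  | succ n ih =>
    have e : ∏ i ∈ Finset.range n, (w + z * q ^ (i + 1)) =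
        ∏ i ∈ Finset.range n, (w + z * q * q ^ i) :=
      Finset.prod_congr rfl fun i _ => by ring
    rw [Finset.prod_range_succ', e, ih, Finset.sum_range_succ' _ (n + 1)]
    simp only [gaussBinom_succ_succ, gaussBinom_zero_right]
    have h₁ : ∑ k ∈ Finset.range (n + 1),
        q ^ (k.choose 2) * gaussBinom q n k * (z * q) ^ k * w ^ (n - k) * z =
        ∑ k ∈ Finset.range (n + 1), q ^ ((k + 1).choose 2) * gaussBinom q n k * z ^ (k + 1) *
          w ^ (n + 1 - (k + 1)) := by
      refine Finset.sum_congr rfl fun k _ => ?_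
      rw [Nat.choose_succ_succ', Nat.choose_one_right, Nat.add_sub_add_right]
      ring
    have h₂ : ∑ k ∈ Finset.range (n + 1),
        q ^ (k.choose 2) * gaussBinom q n k * (z * q) ^ k * w ^ (n - k) * w =
        ∑ k ∈ Finset.range (n + 1), q ^ ((k + 1).choose 2) * (q ^ (k + 1) * gaussBinom q n (k + 1)) *
          z ^ (k + 1) * w ^ (n + 1 - (k + 1)) + w ^ (n + 1) := by
      rw [Finset.sum_range_succ', Finset.sum_range_succ _ n, gaussBinom_of_lt q n.lt_succ_self]
      simp only [gaussBinom_zero_right, Nat.choose_zero_succ, pow_zero, Nat.sub_zero, mul_zero,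
        zero_mul, add_zero, mul_one, one_mul, pow_succ w n]
      congr 1
      refine Finset.sum_congr rfl fun k hk => ?_
      rw [Finset.mem_range] at hk
      rw [Nat.choose_succ_succ' k 1, Nat.choose_one_right, Nat.add_sub_add_right,
        show n - k = n - (k + 1) + 1 by omega]
      ring
    rw [mul_add, Finset.sum_mul, Finset.sum_mul, pow_zero, mul_one, h₁, h₂]
    simp only [mul_add, add_mul, Finset.sum_add_distrib, Nat.choose_zero_succ, pow_zero, one_mul,
      Nat.sub_zero, mul_one]
    ring

theorem pow_dvd_qPochhammer_sub (n m : ℕ) :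
    q ^ (n + 1) ∣ qPochhammer q (n + m) - qPochhammer q n := by
  induction m with
  | zero => simp
  | succ m ih =>
    rw [← add_assoc, qPochhammer_succ, mul_sub, mul_one, sub_right_comm]
    exact dvd_sub ih ((pow_dvd_pow q (by omega)).mul_left _)

end QBinomial

section Gauss

open PowerSeries

variable (K : Type*) [Field K]

/-- The product `∏_{i < n} (1 - X ^ (2 * i + 1))`. -/
noncomputable def oddProd (n : ℕ) : K⟦X⟧ := ∏ i ∈ Finset.range n, (1 - X ^ (2 * i + 1))

/-- A finite form of Gauss's identity. -/
theorem oddProd_sq (n : ℕ) : oddProd K n ^ 2 =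
    ∑ k ∈ Finset.range (2 * n + 1),
      (-1) ^ (k + n) * X ^ (((k : ℤ) - n).natAbs ^ 2) * gaussBinom (X ^ 2 : K⟦X⟧) (2 * n) k := by
  have h := prod_add_mul_pow (X ^ 2 : K⟦X⟧) (X ^ (2 * n)) (-X) (2 * n)
  have h₁ : ∏ i ∈ Finset.range n, ((X : K⟦X⟧) ^ (2 * n) + -X * (X ^ 2) ^ i) =
      (-1) ^ n * X ^ (n ^ 2) * oddProd K n := by
    have e : (X : K⟦X⟧) ^ (n ^ 2) = ∏ i ∈ Finset.range n, X ^ (2 * i + 1) := by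
      rw [Finset.prod_pow_eq_pow_sum]
      congr 1
      clear h
      induction n with
      | zero => rfl
      | succ n ih => rw [Finset.sum_range_succ, ← ih]; ring
    rw [e, oddProd, ← Finset.prod_range_reflect (fun i => 1 - (X : K⟦X⟧) ^ (2 * i + 1)),
      ← Finset.card_range n, ← Finset.prod_const, Finset.card_range, ← Finset.prod_mul_distrib,
      ← Finset.prod_mul_distrib]
    refine Finset.prod_congr rfl fun i hi => ?_
    rw [Finset.mem_range] at hi
    obtain ⟨j, rfl⟩ := Nat.exists_eq_add_of_lt hi
    rw [show i + j + 1 - 1 - i = j by omega]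
    ring
  have h₂ : ∏ i ∈ Finset.range n, ((X : K⟦X⟧) ^ (2 * n) + -X * (X ^ 2) ^ (n + i)) =
      X ^ (2 * n ^ 2) * oddProd K n := by
    have e : (X : K⟦X⟧) ^ (2 * n ^ 2) = ∏ i ∈ Finset.range n, X ^ (2 * n) := by
      simp only [Finset.prod_const, Finset.card_range]
      ring
    rw [e, oddProd, ← Finset.prod_mul_distrib]
    exact Finset.prod_congr rfl fun i _ => by ring
  nth_rw 1 [two_mul n] at h
  rw [Finset.prod_range_add, h₁, h₂] at h
  have hX : ((-1) ^ n * X ^ (3 * n ^ 2) : K⟦X⟧) ≠ 0 :=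
    mul_ne_zero (pow_ne_zero _ (by simp)) (pow_ne_zero _ X_ne_zero)
  refine mul_left_cancel₀ hX ?_
  have h' : (-1) ^ n * X ^ (3 * n ^ 2) * oddProd K n ^ 2 =
      (-1) ^ n * X ^ (n ^ 2) * oddProd K n * (X ^ (2 * n ^ 2) * oddProd K n) := by ring
  rw [h', h, Finset.mul_sum]
  refine Finset.sum_congr rfl fun k hk => ?_
  rw [Finset.mem_range] at hk
  have e : 2 * k.choose 2 + k + 2 * n * (2 * n - k) = 3 * n ^ 2 + ((k : ℤ) - n).natAbs ^ 2 := by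
    have hc : 2 * k.choose 2 + k = k ^ 2 := by
      rw [Nat.choose_two_right, Nat.mul_div_cancel' (Nat.even_mul_pred_self k).two_dvd]
      cases k <;> simp
      ring
    rw [hc]
    zify [show k ≤ 2 * n by omega]
    rw [sq_abs]
    ring
  have s : ((-1) ^ n * (-1) ^ n : K⟦X⟧) = 1 := by rw [← mul_pow]; simp
  calc _ = (-1) ^ k * X ^ (2 * k.choose 2 + k + 2 * n * (2 * n - k)) *
        gaussBinom (X ^ 2 : K⟦X⟧) (2 * n) k := by
        rw [neg_pow (X : K⟦X⟧)]
        ring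
    _ = _ := by
        rw [e, pow_add _ k n]
        linear_combination (-(-1) ^ k * X ^ (3 * n ^ 2) * X ^ (((k : ℤ) - n).natAbs ^ 2) *
          gaussBinom (X ^ 2 : K⟦X⟧) (2 * n) k) * s

theorem isUnit_qPochhammer_X_sq (n : ℕ) : IsUnit (qPochhammer (X ^ 2 : K⟦X⟧) n) := by
  rw [isUnit_iff_constantCoeff, qPochhammer, map_prod]
  simp

theorem X_pow_dvd_gaussBinom_sub (n k : ℕ) (hk : k ≤ 2 * n) :
    (X : K⟦X⟧) ^ (2 * n + 1) ∣ X ^ (((k : ℤ) - n).natAbs ^ 2) *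
      (qPochhammer (X ^ 2) n * gaussBinom (X ^ 2) (2 * n) k - 1) := by
  obtain ⟨l, hl⟩ := Nat.exists_eq_add_of_le hk
  have h := gaussBinom_mul_qPochhammer (X ^ 2 : K⟦X⟧) k l
  rw [← hl] at h
  rw [← ((isUnit_qPochhammer_X_sq K k).mul (isUnit_qPochhammer_X_sq K l)).dvd_mul_right]
  have e : X ^ (((k : ℤ) - n).natAbs ^ 2) * (qPochhammer (X ^ 2 : K⟦X⟧) n *
      gaussBinom (X ^ 2) (2 * n) k - 1) * (qPochhammer (X ^ 2) k * qPochhammer (X ^ 2) l) =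
      X ^ (((k : ℤ) - n).natAbs ^ 2) * (qPochhammer (X ^ 2) n * qPochhammer (X ^ 2) (2 * n) -
        qPochhammer (X ^ 2) k * qPochhammer (X ^ 2) l) := by
    rw [← h]
    ring
  rw [e]
  have key (r j : ℕ) (hr : n = r + j) : (X : K⟦X⟧) ^ (2 * n + 1) ∣ X ^ (j ^ 2) *
      (qPochhammer (X ^ 2) n * qPochhammer (X ^ 2) (2 * n) -
        qPochhammer (X ^ 2) r * qPochhammer (X ^ 2) (n + j)) := by
    obtain ⟨a, ha⟩ := pow_dvd_qPochhammer_sub (X ^ 2 : K⟦X⟧) r j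
    obtain ⟨b, hb⟩ := pow_dvd_qPochhammer_sub (X ^ 2 : K⟦X⟧) (r + (j + j)) r
    rw [← hr] at ha
    rw [show r + (j + j) + r = 2 * n by omega, show r + (j + j) = n + j by omega] at hb
    refine (pow_dvd_pow X (?_ : 2 * n + 1 ≤ j ^ 2 + 2 * (r + 1))).trans ?_
    · zify
      nlinarith [sq_nonneg ((j : ℤ) - 1)]
    rw [pow_add, pow_mul]
    refine mul_dvd_mul_left _ ⟨a * qPochhammer (X ^ 2) (2 * n) +
      qPochhammer (X ^ 2) r * (X ^ 2) ^ (2 * j) * b, ?_⟩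
    have e : ((X : K⟦X⟧) ^ 2) ^ (n + j + 1) = (X ^ 2) ^ (r + 1) * (X ^ 2) ^ (2 * j) := by
      rw [← pow_add, hr]
      ring_nf
    rw [e] at hb
    linear_combination qPochhammer (X ^ 2 : K⟦X⟧) (2 * n) * ha + qPochhammer (X ^ 2 : K⟦X⟧) r * hb
  rcases le_total k n with hkn | hkn
  · obtain ⟨j, hj⟩ := Nat.exists_eq_add_of_le hkn
    rw [show ((k : ℤ) - n).natAbs = j by omega, show l = n + j by omega]
    exact key k j hj
  · obtain ⟨j, hj⟩ := Nat.exists_eq_add_of_le hkn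
    rw [show ((k : ℤ) - n).natAbs = j by omega, mul_comm (qPochhammer (X ^ 2 : K⟦X⟧) k), hj]
    exact key l j (by omega)

/-- The theta series `∑ (-1) ^ x * X ^ (x ^ 2)`. -/
noncomputable def thetaNeg : K⟦X⟧ := weightSeries (fun x : ℤ => x.natAbs ^ 2) fun x => (-1) ^ x

/-- The theta series `∑ X ^ (x ^ 2)`. -/
noncomputable def theta : K⟦X⟧ := weightSeries (fun x : ℤ => x.natAbs ^ 2) fun _ => 1

theorem coeff_thetaNeg_eq {d n : ℕ} (h : d ≤ n) :
    coeff d (qPochhammer (X ^ 2) n * oddProd K n ^ 2) = coeff d (thetaNeg K) := by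
  have h₁ : (X : K⟦X⟧) ^ (2 * n + 1) ∣ qPochhammer (X ^ 2) n * oddProd K n ^ 2 -
      ∑ k ∈ Finset.range (2 * n + 1), (-1) ^ (k + n) * X ^ (((k : ℤ) - n).natAbs ^ 2) := by
    rw [oddProd_sq, Finset.mul_sum, ← Finset.sum_sub_distrib]
    refine Finset.dvd_sum fun k hk => ?_
    rw [Finset.mem_range] at hk
    convert (X_pow_dvd_gaussBinom_sub K n k (by omega)).mul_left ((-1) ^ (k + n)) using 1
    ring
  have h₂ := X_pow_dvd_iff.1 h₁ d (by omega)
  rw [map_sub, sub_eq_zero] at h₂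
  rw [h₂, thetaNeg, map_sum, coeff_weightSeries
    ((Finset.Icc (-n : ℤ) n).filter fun x => x.natAbs ^ 2 = d), Finset.sum_filter]
  · refine Finset.sum_nbij' (fun k => (k : ℤ) - n) (fun x => (x + n).toNat) ?_ ?_ ?_ ?_ ?_
    · intro k hk
      simp only [Finset.mem_range, Finset.mem_Icc] at hk ⊢
      omega
    · intro x hx
      simp only [Finset.mem_range, Finset.mem_Icc] at hx ⊢
      omega
    · intro k hk
      simp
    · intro x hx
      simp only [Finset.mem_Icc] at hx ⊢
      omega
    · intro k hk
      rw [show ((-1) ^ (k + n) : K⟦X⟧) = C ((-1) ^ (k + n)) by simp, coeff_C_mul, coeff_X_pow,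
        mul_ite, mul_one, mul_zero, zpow_sub₀ (by simp), zpow_natCast, zpow_natCast, pow_add]
      have : ((-1) ^ n * (-1) ^ n : K) = 1 := by rw [← mul_pow]; simp
      rw [div_eq_mul_inv, inv_eq_of_mul_eq_one_left this]
      simp only [eq_comm]
  · intro x
    simp only [Finset.mem_filter, Finset.mem_Icc, and_iff_right_iff_imp]
    rintro rfl
    have := Nat.le_self_pow two_ne_zero x.natAbs
    omega

end Gauss

section GeneratingFunction

open PowerSeries PowerSeries.WithPiTopology Filter Topology

variable (K : Type*) [Field K]

theorem mk_pbarOdd : (PowerSeries.mk fun n => (pbarOdd n : K)) =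
    PowerSeries.mk (fun n => ((Nat.Partition.oddDistincts n).card : K)) *
      PowerSeries.mk fun n => ((Nat.Partition.odds n).card : K) := by
  ext n
  rw [coeff_mul, Finset.Nat.sum_antidiagonal_eq_sum_range_succ_mk]
  simp [pbarOdd]

theorem prod_range_two_mul_ite {M : Type*} [CommMonoid M] (g : ℕ → M) (n : ℕ) :
    ∏ i ∈ Finset.range (2 * n), (if ¬ Even (i + 1) then g (i + 1) else 1) =
      ∏ i ∈ Finset.range n, g (2 * i + 1) := by
  induction n with
  | zero => rfl
  | succ n ih =>
    rw [Nat.mul_add, mul_one, Finset.prod_range_succ, Finset.prod_range_succ, ih,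
      Finset.prod_range_succ, if_pos, if_neg, mul_one]
    · simp [show 2 * n + 1 + 1 = 2 * (n + 1) by ring]
    · simp

theorem expand_oddProd (n : ℕ) : expand 2 two_ne_zero (oddProd K n) =
    oddProd K n * ∏ i ∈ Finset.range n, (1 + (X : K⟦X⟧) ^ (2 * i + 1)) := by
  rw [oddProd, map_prod, ← Finset.prod_mul_distrib]
  refine Finset.prod_congr rfl fun i _ => ?_
  rw [map_sub, map_one, map_pow, expand_X]
  ring

theorem expand_qPochhammer_mul (n : ℕ) :
    expand 2 two_ne_zero (qPochhammer (X ^ 2) n) * expand 2 two_ne_zero (oddProd K n) =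
      qPochhammer (X ^ 2) (2 * n) := by
  simp only [qPochhammer, oddProd, map_prod, map_sub, map_one, map_pow, expand_X]
  induction n with
  | zero => simp
  | succ n ih =>
    rw [Finset.prod_range_succ, Finset.prod_range_succ, Nat.mul_add, mul_one,
      Finset.prod_range_succ _ (2 * n + 1), Finset.prod_range_succ _ (2 * n), ← ih]
    ring

theorem tendsto_of_coeff_eq [TopologicalSpace K] {u : ℕ → K⟦X⟧} {a : K⟦X⟧}
    (h : ∀ d n, d ≤ n → coeff d (u n) = coeff d a) : Tendsto u atTop (𝓝 a) := by
  rw [tendsto_iff_coeff_tendsto]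
  exact fun d => tendsto_atTop_of_eventually_const (i₀ := d) fun n hn => h d n hn

section Topology

variable [TopologicalSpace K] [DiscreteTopology K]

theorem tendsto_oddDistincts :
    Tendsto (fun n => ∏ i ∈ Finset.range n, (1 + (X : K⟦X⟧) ^ (2 * i + 1))) atTop
      (𝓝 (PowerSeries.mk fun n => ((Nat.Partition.oddDistincts n).card : K))) := by
  have h : HasProd (fun i ↦ if ¬ Even (i + 1) then 1 + (X : K⟦X⟧) ^ (i + 1) else 1)
      (PowerSeries.mk fun n ↦ ((Nat.Partition.oddDistincts n).card : K)) := by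
    convert! Nat.Partition.hasProd_genFun
      (fun i c ↦ if ¬ Even i ∧ c < 2 then (1 : K) else 0) using 1
    · ext1 i
      split_ifs with h
      · rw [tsum_eq_single 0]
        · simp [h]
        · intro j hj
          simp [hj]
      · simp [h]
    · simp_rw [Nat.Partition.genFun, Nat.Partition.oddDistincts, ← Nat.Partition.countRestricted_two,
        Nat.Partition.odds, Nat.Partition.restricted, Nat.Partition.countRestricted,
        ← Finset.filter_and, Finset.card_filter, Finsupp.prod, Finset.prod_boole]
      simp [forall_and]
  have := h.tendsto_prod_nat.comp (tendsto_id.const_mul_atTop' (r := 2) (by norm_num))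
  refine this.congr fun n => ?_
  exact prod_range_two_mul_ite (fun i => 1 + (X : K⟦X⟧) ^ i) n

theorem exists_tendsto_odds : ∃ g : ℕ → K⟦X⟧, (∀ n, g n * oddProd K n = 1) ∧
    Tendsto g atTop (𝓝 (PowerSeries.mk fun n => ((Nat.Partition.odds n).card : K))) := by
  refine ⟨fun n => ∏ i ∈ Finset.range n, ∑' j : ℕ, X ^ ((2 * i + 1) * j), fun n => ?_, ?_⟩
  · rw [oddProd, ← Finset.prod_mul_distrib]
    refine Finset.prod_eq_one fun i _ => ?_
    simp_rw [pow_mul]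
    exact tsum_pow_mul_one_sub_of_constantCoeff_eq_zero (by simp)
  · have h := Nat.Partition.hasProd_powerSeriesMk_card_restricted K (¬ Even ·)
    refine (h.tendsto_prod_nat.comp
      (tendsto_id.const_mul_atTop' (r := 2) (by norm_num))).congr fun n => ?_
    exact prod_range_two_mul_ite (fun i => ∑' j : ℕ, (X : K⟦X⟧) ^ (i * j)) n

end Topology

theorem mk_pbarOdd_mul_thetaNeg : (PowerSeries.mk fun n => (pbarOdd n : K)) * thetaNeg K =
    expand 2 two_ne_zero (thetaNeg K) := by
  let _ : TopologicalSpace K := ⊥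
  have _ : DiscreteTopology K := ⟨rfl⟩
  obtain ⟨g, hg, hg'⟩ := exists_tendsto_odds K
  have hθ : Tendsto (fun n => qPochhammer (X ^ 2) n * oddProd K n ^ 2) atTop (𝓝 (thetaNeg K)) :=
    tendsto_of_coeff_eq K fun d n h => coeff_thetaNeg_eq K h
  have h₁ := ((tendsto_oddDistincts K).mul hg').mul hθ
  rw [← mk_pbarOdd] at h₁
  refine tendsto_nhds_unique h₁ (tendsto_of_coeff_eq K fun d n h => ?_)
  have e : coeff d (expand 2 two_ne_zero (thetaNeg K)) =
      coeff d (expand 2 two_ne_zero (qPochhammer (X ^ 2) n * oddProd K n ^ 2)) := by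
    rw [coeff_expand, coeff_expand, coeff_thetaNeg_eq K ((Nat.div_le_self d 2).trans h)]
  rw [e, map_mul (expand 2 two_ne_zero), map_pow (expand 2 two_ne_zero),
    sq (expand 2 two_ne_zero (oddProd K n)),
    ← mul_assoc (expand 2 two_ne_zero _), expand_qPochhammer_mul, eq_comm, ← sub_eq_zero,
    ← map_sub]
  refine X_pow_dvd_iff.1 ?_ d (Nat.lt_succ_of_le h)
  obtain ⟨a, ha⟩ := pow_dvd_qPochhammer_sub (X ^ 2 : K⟦X⟧) n n
  rw [← two_mul, ← pow_mul] at ha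
  refine (pow_dvd_pow X (by omega : n + 1 ≤ 2 * (n + 1))).trans
    ⟨a * expand 2 two_ne_zero (oddProd K n), ?_⟩
  rw [expand_oddProd, ← mul_assoc (X ^ (2 * (n + 1))), ← ha]
  linear_combination -(qPochhammer (X ^ 2) n * oddProd K n *
    ∏ i ∈ Finset.range n, (1 + (X : K⟦X⟧) ^ (2 * i + 1))) * hg n

end GeneratingFunction

section ThetaIdentities

open PowerSeries

theorem finite_natAbs_sq (n : ℕ) : {x : ℤ | x.natAbs ^ 2 = n}.Finite := by
  refine (Set.finite_Icc (-n : ℤ) n).subset ?_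
  rintro x rfl
  have := Nat.le_self_pow two_ne_zero x.natAbs
  rw [Set.mem_Icc]
  omega

theorem finite_mul_natAbs_sq {k : ℕ} (hk : k ≠ 0) (n : ℕ) :
    {x : ℤ | k * x.natAbs ^ 2 = n}.Finite :=
  (finite_natAbs_sq (n / k)).subset fun x hx => by
    simp only [Set.mem_ofPred_eq] at hx ⊢
    rw [← hx, Nat.mul_div_cancel_left _ (Nat.pos_of_ne_zero hk)]

theorem neg_one_zpow_eq_of_even_sub (K : Type*) [Field K] {m n : ℤ} (h : Even (m - n)) :
    (-1 : K) ^ m = (-1) ^ n := by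
  rw [← sub_add_cancel m n, zpow_add₀ (by simp), h.neg_one_zpow, one_mul]

theorem expand_thetaNeg (K : Type*) [Field K] {k : ℕ} (hk : k ≠ 0) :
    expand k hk (thetaNeg K) =
      weightSeries (fun x : ℤ => k * x.natAbs ^ 2) fun x => (-1) ^ x :=
  expand_weightSeries hk

theorem thetaNeg_ne_zero (K : Type*) [Field K] : thetaNeg K ≠ 0 := by
  intro h
  have := coeff_thetaNeg_eq K (le_refl 0)
  simp [h, qPochhammer, oddProd] at this

theorem theta_mul_thetaNeg (K : Type*) [Field K] :
    theta K * thetaNeg K = expand 2 two_ne_zero (thetaNeg K) ^ 2 := by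
  classical
  have h₂ := finite_mul_natAbs_sq two_ne_zero
  rw [sq, expand_thetaNeg, weightSeries_mul h₂ h₂, theta, thetaNeg,
    weightSeries_mul finite_natAbs_sq finite_natAbs_sq]
  ext n
  rw [coeff_weightSeries (finite_weight_add finite_natAbs_sq finite_natAbs_sq n).toFinset (by simp),
    coeff_weightSeries (finite_weight_add h₂ h₂ n).toFinset (by simp),
    ← Finset.sum_filter_add_sum_filter_not _ fun z : ℤ × ℤ => Even (z.1 + z.2)]
  have hodd : ∑ z ∈ (finite_weight_add finite_natAbs_sq finite_natAbs_sq n).toFinset with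
      ¬ Even (z.1 + z.2), 1 * (-1 : K) ^ z.2 = 0 := by
    refine Finset.sum_involution (fun z _ => z.swap) ?_ ?_ ?_ ?_
    · rintro ⟨x, y⟩ h
      simp only [Finset.mem_filter, Int.not_even_iff_odd] at h
      have : Even (x - (y + 1)) := by
        rw [Int.odd_iff] at h
        rw [Int.even_iff]
        omega
      rw [Prod.snd_swap, neg_one_zpow_eq_of_even_sub K this, zpow_add₀ (by simp)]
      simp
    · rintro ⟨x, y⟩ h - e
      obtain rfl : y = x := congrArg Prod.fst e
      exact (Finset.mem_filter.1 h).2 ⟨y, rfl⟩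
    · rintro ⟨x, y⟩ h
      simp only [Finset.mem_filter, Set.Finite.mem_toFinset, Set.mem_ofPred_eq, Prod.fst_swap,
        Prod.snd_swap] at h ⊢
      rwa [add_comm, add_comm y]
    · rintro ⟨x, y⟩ h
      rfl
  rw [hodd, add_zero]
  refine Finset.sum_nbij' (fun z => ((z.1 + z.2) / 2, (z.1 - z.2) / 2))
    (fun z => (z.1 + z.2, z.1 - z.2)) ?_ ?_ ?_ ?_ ?_
  · rintro ⟨x, y⟩ h
    simp only [Finset.mem_filter, Set.Finite.mem_toFinset, Set.mem_ofPred_eq] at h ⊢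
    obtain ⟨h, k, hk⟩ := h
    obtain rfl : x = k + k - y := by omega
    rw [show (k + k - y + y) / 2 = k by omega, show (k + k - y - y) / 2 = k - y by omega]
    zify at h ⊢
    simp only [sq_abs] at h ⊢
    linear_combination h
  · rintro ⟨x, y⟩ h
    simp only [Finset.mem_filter, Set.Finite.mem_toFinset, Set.mem_ofPred_eq] at h ⊢
    refine ⟨?_, ⟨x, by ring⟩⟩
    zify at h ⊢
    simp only [sq_abs] at h ⊢
    linear_combination h
  · rintro ⟨x, y⟩ h
    simp only [Finset.mem_filter, Int.even_iff] at h
    simp only [Prod.mk.injEq]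
    omega
  · rintro ⟨x, y⟩ h
    simp only [Prod.mk.injEq]
    omega
  · rintro ⟨x, y⟩ h
    simp only [Finset.mem_filter, Int.even_iff] at h
    rw [one_mul, ← zpow_add₀ (by simp)]
    refine neg_one_zpow_eq_of_even_sub K ?_
    rw [Int.even_iff]
    omega

end ThetaIdentities

section Trisection

open PowerSeries

/-- The series `∑ a (3 * n) * X ^ n` attached to `∑ a n * X ^ n`. -/
noncomputable def trisect {R : Type*} [Semiring R] (F : R⟦X⟧) : R⟦X⟧ :=
  PowerSeries.mk fun n => coeff (3 * n) F

theorem trisect_mul_expand {R : Type*} [CommRing R] (F G : R⟦X⟧) :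
    trisect (F * expand 3 three_ne_zero G) = trisect F * G := by
  ext n
  rw [trisect, coeff_mk, coeff_mul, coeff_mul]
  refine (Finset.sum_of_injOn (fun z => (3 * z.1, 3 * z.2)) ?_ ?_ ?_ ?_).symm
  · rintro ⟨a, b⟩ _ ⟨c, d⟩ _ h
    simpa using h
  · rintro ⟨a, b⟩ h
    simp only [Finset.mem_coe, Finset.HasAntidiagonal.mem_antidiagonal] at h ⊢
    omega
  · rintro ⟨a, b⟩ h h'
    rw [Finset.HasAntidiagonal.mem_antidiagonal] at h
    rw [coeff_expand_of_not_dvd, mul_zero]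
    rintro ⟨c, rfl⟩
    refine h' ⟨(n - c, c), ?_, ?_⟩
    · simp only [Finset.mem_coe, Finset.HasAntidiagonal.mem_antidiagonal]
      omega
    · simp only [Prod.mk.injEq, and_true]
      omega
  · rintro ⟨a, b⟩ _
    rw [trisect, coeff_mk, coeff_expand_mul]

theorem expand_eq_pow (p : ℕ) [hp : Fact p.Prime] (F : (ZMod p)⟦X⟧) :
    expand p hp.out.ne_zero F = F ^ p := by
  have h := MvPowerSeries.map_frobenius_expand p hp.out.ne_zero (f := F)
  rw [ZMod.frobenius_zmod] at h
  rw [← h, MvPowerSeries.map_id]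
  rfl

theorem sum_indicators_eq_one (x y z : ZMod 3) (h : x ^ 2 + y ^ 2 + 2 * z ^ 2 = 0) :
    (if x = 0 ∧ y = z then 1 else 0) + (if x = 0 ∧ y = -z then 1 else 0) +
      (if y = 0 ∧ x = z then 1 else 0) + (if y = 0 ∧ x = -z then 1 else 0) = (1 : ZMod 3) := by
  revert x y z
  decide

theorem trisect_thetaNeg_sq_mul : trisect (thetaNeg (ZMod 3) * thetaNeg (ZMod 3) *
      expand 2 two_ne_zero (thetaNeg (ZMod 3))) =
    expand 3 three_ne_zero (thetaNeg (ZMod 3)) * theta (ZMod 3) *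
      expand 2 two_ne_zero (thetaNeg (ZMod 3)) := by
  have h₁ := finite_natAbs_sq
  have h₂ := finite_mul_natAbs_sq two_ne_zero
  have h₃ := finite_mul_natAbs_sq three_ne_zero
  rw [expand_thetaNeg, expand_thetaNeg, thetaNeg, theta, weightSeries_mul h₁ h₁,
    weightSeries_mul (finite_weight_add h₁ h₁) h₂, weightSeries_mul h₃ h₁,
    weightSeries_mul (finite_weight_add h₃ h₁) h₂]
  ext n
  rw [trisect, coeff_mk]
  obtain ⟨S, hS⟩ : ∃ S, S = (finite_weight_add (finite_weight_add h₁ h₁) h₂ (3 * n)).toFinset :=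
    ⟨_, rfl⟩
  have mem_S (x y z : ℤ) : ((x, y), z) ∈ S ↔ x ^ 2 + y ^ 2 + 2 * z ^ 2 = 3 * n := by
    simp only [hS, Set.Finite.mem_toFinset, Set.mem_ofPred_eq]
    zify
    simp only [sq_abs]
  rw [coeff_weightSeries S (by simp [hS]), coeff_weightSeries
    (finite_weight_add (finite_weight_add h₃ h₁) h₂ n).toFinset (by simp)]
  have base : ∑ z ∈ S with (z.1.1 : ZMod 3) = 0 ∧ (z.1.2 : ZMod 3) = z.2,
      (-1 : ZMod 3) ^ z.1.1 * (-1) ^ z.1.2 * (-1) ^ z.2 =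
      ∑ z ∈ (finite_weight_add (finite_weight_add h₃ h₁) h₂ n).toFinset,
        (-1 : ZMod 3) ^ z.1.1 * 1 * (-1) ^ z.2 := by
    refine Finset.sum_nbij'
      (fun z => ((z.1.1 / 3, z.2 + (z.1.2 - z.2) / 3), (z.1.2 - z.2) / 3))
      (fun z => ((3 * z.1.1, z.1.2 + 2 * z.2), z.1.2 - z.2)) ?_ ?_ ?_ ?_ ?_
    · rintro ⟨⟨x, y⟩, z⟩ h
      simp only [Finset.mem_filter, mem_S, ← sub_eq_zero (a := (y : ZMod 3)), ← Int.cast_sub,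
        ZMod.intCast_zmod_eq_zero_iff_dvd, Nat.cast_ofNat] at h
      obtain ⟨h, ⟨a, rfl⟩, ⟨k, hk⟩⟩ := h
      obtain rfl : y = z + 3 * k := by omega
      simp only [Set.Finite.mem_toFinset, Set.mem_ofPred_eq]
      rw [show 3 * a / 3 = a by omega, show (z + 3 * k - z) / 3 = k by omega]
      zify
      simp only [sq_abs]
      linarith
    · rintro ⟨⟨x, y⟩, z⟩ h
      simp only [Set.Finite.mem_toFinset, Set.mem_ofPred_eq] at h
      zify at h
      simp only [sq_abs] at h
      simp only [Finset.mem_filter, mem_S, ← sub_eq_zero (b := ((y - z : ℤ) : ZMod 3)),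
        ← Int.cast_sub, ZMod.intCast_zmod_eq_zero_iff_dvd, Nat.cast_ofNat]
      refine ⟨by linarith, by omega, by omega⟩
    · rintro ⟨⟨x, y⟩, z⟩ h
      simp only [Finset.mem_filter, ← sub_eq_zero (a := (y : ZMod 3)), ← Int.cast_sub,
        ZMod.intCast_zmod_eq_zero_iff_dvd, Nat.cast_ofNat] at h
      simp only [Prod.mk.injEq]
      omega
    · rintro ⟨⟨x, y⟩, z⟩ h
      simp only [Prod.mk.injEq]
      omega
    · rintro ⟨⟨x, y⟩, z⟩ h
      simp only [Finset.mem_filter, ← sub_eq_zero (a := (y : ZMod 3)), ← Int.cast_sub,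
        ZMod.intCast_zmod_eq_zero_iff_dvd, Nat.cast_ofNat] at h
      rw [mul_one, ← zpow_add₀ (by simp), ← zpow_add₀ (by simp), ← zpow_add₀ (by simp)]
      refine neg_one_zpow_eq_of_even_sub _ ?_
      rw [Int.even_iff]
      dsimp only
      omega
  have neg (P : ZMod 3 → ZMod 3 → ZMod 3 → Prop) [∀ x y z, Decidable (P x y z)] :
      ∑ z ∈ S with P z.1.1 z.1.2 (-z.2), (-1 : ZMod 3) ^ z.1.1 * (-1) ^ z.1.2 * (-1) ^ z.2 =
      ∑ z ∈ S with P z.1.1 z.1.2 z.2, (-1 : ZMod 3) ^ z.1.1 * (-1) ^ z.1.2 * (-1) ^ z.2 := by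
    refine Finset.sum_nbij' (fun z => (z.1, -z.2)) (fun z => (z.1, -z.2)) ?_ ?_ ?_ ?_ ?_ <;>
    rintro ⟨⟨x, y⟩, z⟩ h
    · simpa [mem_S] using h
    · simpa [mem_S] using h
    · simp
    · simp
    · simp [zpow_neg, ← inv_zpow]
  have swap (P : ZMod 3 → ZMod 3 → ZMod 3 → Prop) [∀ x y z, Decidable (P x y z)] :
      ∑ z ∈ S with P z.1.2 z.1.1 z.2, (-1 : ZMod 3) ^ z.1.1 * (-1) ^ z.1.2 * (-1) ^ z.2 =
      ∑ z ∈ S with P z.1.1 z.1.2 z.2, (-1 : ZMod 3) ^ z.1.1 * (-1) ^ z.1.2 * (-1) ^ z.2 := by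
    refine Finset.sum_nbij' (fun z => (z.1.swap, z.2)) (fun z => (z.1.swap, z.2)) ?_ ?_ ?_ ?_ ?_ <;>
    rintro ⟨⟨x, y⟩, z⟩ h
    · simpa [mem_S, add_comm] using h
    · simpa [mem_S, add_comm] using h
    · simp
    · simp
    · simp [mul_comm]
  have split : ∑ z ∈ S, (-1 : ZMod 3) ^ z.1.1 * (-1) ^ z.1.2 * (-1) ^ z.2 =
      ∑ z ∈ S, ((if (z.1.1 : ZMod 3) = 0 ∧ (z.1.2 : ZMod 3) = z.2 then
          (-1 : ZMod 3) ^ z.1.1 * (-1) ^ z.1.2 * (-1) ^ z.2 else 0) +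
        (if (z.1.1 : ZMod 3) = 0 ∧ (z.1.2 : ZMod 3) = -z.2 then
          (-1 : ZMod 3) ^ z.1.1 * (-1) ^ z.1.2 * (-1) ^ z.2 else 0) +
        (if (z.1.2 : ZMod 3) = 0 ∧ (z.1.1 : ZMod 3) = z.2 then
          (-1 : ZMod 3) ^ z.1.1 * (-1) ^ z.1.2 * (-1) ^ z.2 else 0) +
        (if (z.1.2 : ZMod 3) = 0 ∧ (z.1.1 : ZMod 3) = -z.2 then
          (-1 : ZMod 3) ^ z.1.1 * (-1) ^ z.1.2 * (-1) ^ z.2 else 0)) := by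
    refine Finset.sum_congr rfl ?_
    rintro ⟨⟨x, y⟩, z⟩ h
    rw [mem_S] at h
    have h' := congrArg (Int.cast : ℤ → ZMod 3) h
    push_cast at h'
    rw [show (3 : ZMod 3) = 0 from rfl, zero_mul] at h'
    have key := congrArg ((-1 : ZMod 3) ^ x * (-1) ^ y * (-1) ^ z * ·)
      (sum_indicators_eq_one x y z h')
    simp only [mul_add, mul_ite, mul_one, mul_zero] at key
    exact key.symm
  rw [split]
  simp only [Finset.sum_add_distrib, ← Finset.sum_filter]
  rw [neg fun x y z => x = 0 ∧ y = z, neg fun x y z => y = 0 ∧ x = z,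
    swap fun x y z => x = 0 ∧ y = z, base]
  exact (by decide : ∀ s : ZMod 3, s + s + s + s = s) _

theorem trisect_mk_pbarOdd : trisect (PowerSeries.mk fun n => (pbarOdd n : ZMod 3)) =
    thetaNeg (ZMod 3) * expand 6 (by decide) (thetaNeg (ZMod 3)) := by
  have h₁ := mk_pbarOdd_mul_thetaNeg (ZMod 3)
  have h₂ := trisect_mul_expand (PowerSeries.mk fun n => (pbarOdd n : ZMod 3)) (thetaNeg (ZMod 3))
  have h₃ := trisect_thetaNeg_sq_mul
  have h₄ := theta_mul_thetaNeg (ZMod 3)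
  have h₅ : expand 6 (by decide) (thetaNeg (ZMod 3)) =
      expand 2 two_ne_zero (thetaNeg (ZMod 3)) ^ 3 := by
    rw [← expand_eq_pow 3]
    exact expand_mul 3 three_ne_zero 2 two_ne_zero _
  have h₆ := expand_eq_pow 3 (thetaNeg (ZMod 3))
  have h₇ : (PowerSeries.mk fun n => (pbarOdd n : ZMod 3)) *
      expand 3 three_ne_zero (thetaNeg (ZMod 3)) =
      thetaNeg (ZMod 3) * thetaNeg (ZMod 3) * expand 2 two_ne_zero (thetaNeg (ZMod 3)) := by
    rw [h₆]
    linear_combination thetaNeg (ZMod 3) ^ 2 * h₁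
  rw [h₇, h₃, h₆] at h₂
  refine mul_right_cancel₀ (thetaNeg_ne_zero (ZMod 3)) ?_
  rw [h₅, ← h₂]
  linear_combination thetaNeg (ZMod 3) ^ 2 * expand 2 two_ne_zero (thetaNeg (ZMod 3)) * h₄

theorem neg_one_zpow_add_eq_f {x y : ℤ} {n : ℕ} (h : x ^ 2 + 6 * y ^ 2 = n) :
    (-1 : ZMod 3) ^ (x + y) = f n := by
  obtain ⟨k, r, hr, hr', rfl⟩ : ∃ k r, 0 ≤ r ∧ r < 6 ∧ x = 6 * k + r :=
    ⟨x / 6, x % 6, by omega, by omega, by omega⟩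
  obtain ⟨l, s, hs, hs', rfl⟩ : ∃ l s, 0 ≤ s ∧ s < 2 ∧ y = 2 * l + s :=
    ⟨y / 2, y % 2, by omega, by omega, by omega⟩
  have e : (n : ℤ) = r ^ 2 + 6 * s ^ 2 + 12 * (3 * k ^ 2 + k * r + 2 * l ^ 2 + 2 * l * s) := by
    rw [← h]
    ring
  generalize 3 * k ^ 2 + k * r + 2 * l ^ 2 + 2 * l * s = c at e
  clear h
  have h₀ : (-1 : ZMod 3) ^ (6 * k + r + (2 * l + s)) = (-1) ^ (r + s) :=
    neg_one_zpow_eq_of_even_sub _ ⟨3 * k + l, by ring⟩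
  rw [h₀, f]
  interval_cases r <;> interval_cases s <;> (split_ifs <;> first | decide | omega)

theorem pbarOdd_three_mul_cast {n : ℕ} :
    (pbarOdd (3 * n) : ZMod 3) = ((f n * (normSols n).card : ℤ) : ZMod 3) := by
  have h := congrArg (coeff n) trisect_mk_pbarOdd
  rw [trisect, coeff_mk, coeff_mk, expand_thetaNeg, thetaNeg,
    weightSeries_mul finite_natAbs_sq (finite_mul_natAbs_sq (by decide)),
    coeff_weightSeries (normSols n)] at h
  · rw [h, Finset.sum_congr rfl (g := fun _ => (f n : ZMod 3))]
    · simp [mul_comm]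
    · rintro ⟨x, y⟩ hz
      rw [← zpow_add₀ (by simp)]
      exact neg_one_zpow_add_eq_f (mem_normSols.1 hz)
  · rintro ⟨x, y⟩
    rw [mem_normSols]
    zify
    simp only [sq_abs]

end Trisection

theorem pbarOdd_formula (n a b r s : ℕ) (p : Fin r → ℕ) (v : Fin r → ℕ)
    (q : Fin s → ℕ) (w : Fin s → ℕ) (hn : 1 ≤ n)
    (hp : ∀ i, (p i).Prime) (hq : ∀ j, (q j).Prime)
    (hpinj : Function.Injective p) (hqinj : Function.Injective q)
    (hpmod : ∀ i, p i % 24 = 1 ∨ p i % 24 = 5 ∨ p i % 24 = 7 ∨ p i % 24 = 11)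
    (hqmod : ∀ j, q j % 24 = 13 ∨ q j % 24 = 17 ∨ q j % 24 = 19 ∨ q j % 24 = 23)
    (hv : ∀ i, 1 ≤ v i) (hw : ∀ j, 1 ≤ w j)
    (hfac : n = 2 ^ a * 3 ^ b * (∏ i, p i ^ v i) * (∏ j, q j ^ w j))
    (t : ℕ) (ht : t = ∑ i, if p i % 24 = 5 ∨ p i % 24 = 11 then v i else 0) :
    (pbarOdd (3 * n) : ℤ) ≡
      f n * (1 + (-1) ^ (a + b + t)) * (∏ i, (1 + (v i : ℤ))) *
        (∏ j, (1 + (-1 : ℤ) ^ (w j)) / 2) [ZMOD 3] := by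
  refine (ZMod.intCast_eq_intCast_iff _ _ 3).1 ?_
  rw [Int.cast_natCast, pbarOdd_three_mul_cast]
  congr 1
  subst ht
  nth_rw 2 [hfac]
  rw [card_normSols_eq a b p v q w hp hq hpinj hqinj hpmod hqmod]
  ring
end
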